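/- If H1 is a right Σ-galaxy and H2 is a right triangular galaxy, then there exists ε > 0 such that every {H1,H2}-free tournament T contains a transitive subtournament of size at least |T|^ε. -/

import Mathlib

open Finset

/-- A tournament on vertex set `Fin n`: `adj u v` means there is an arc from `u` to `v`. -/
structure Tournament (n : ℕ) where
  adj : Fin n → Fin n → Prop
  asymm : ∀ u v, adj u v → ¬ adj v u
  total : ∀ u v, u ≠ v → adj u v ∨ adj v u

namespace Tournament

variable {n N : ℕ}

/-- The position of vertex `v` in the ordering `θ`, where `θ k` is the `k`-th vertex. -/
def pos (θ : Equiv.Perm (Fin n)) (v : Fin n) : Fin n := θ.symm v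

/-- The arc `u → v` of `T` is a backward arc under the ordering `θ`. -/
def Backward (T : Tournament n) (θ : Equiv.Perm (Fin n)) (u v : Fin n) : Prop :=
  T.adj u v ∧ pos θ v < pos θ u

/-- `x` lies strictly between two elements of `L` under the ordering `θ`. -/
def BetweenSet (θ : Equiv.Perm (Fin n)) (L : Finset (Fin n)) (x : Fin n) : Prop :=
  ∃ u ∈ L, ∃ w ∈ L, pos θ u < pos θ x ∧ pos θ x < pos θ w

/-- The induced subtournament of `T` on `s` is transitive. -/
def IsTransOn (T : Tournament n) (s : Finset (Fin n)) : Prop :=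
  ∀ u ∈ s, ∀ v ∈ s, ∀ w ∈ s, T.adj u v → T.adj v w → T.adj u w

/-- The largest size of a transitive subtournament of `T` contained in `s`. -/
noncomputable def trSizeOn (T : Tournament n) (s : Finset (Fin n)) : ℕ :=
  sSup {k | ∃ t, t ⊆ s ∧ T.IsTransOn t ∧ t.card = k}

/-- `tr(T)`: the largest size of a transitive subtournament of `T`. -/
noncomputable def trSize (T : Tournament n) : ℕ := T.trSizeOn Finset.univ

/-- `T` contains `H`: some induced subtournament of `T` is isomorphic to `H`. -/
def Contains (T : Tournament N) (H : Tournament n) : Prop :=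
  ∃ f : Fin n ↪ Fin N, ∀ u v, H.adj u v ↔ T.adj (f u) (f v)

/-- `T` is `ε`-critical. -/
def EpsCritical (T : Tournament n) (ε : ℝ) : Prop :=
  ((T.trSize : ℝ) < (n : ℝ) ^ ε) ∧
  ∀ s : Finset (Fin n), s ≠ Finset.univ → ((s.card : ℝ) ^ ε ≤ (T.trSizeOn s : ℝ))

/-- `S` with center `c` is a right star of `T` under `θ`. -/
def IsRightStarAt (T : Tournament n) (θ : Equiv.Perm (Fin n)) (S : Finset (Fin n))
    (c : Fin n) : Prop :=
  c ∈ S ∧ (S.erase c).Nonempty ∧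
  (∀ v ∈ S.erase c, pos θ v < pos θ c ∧ T.adj c v) ∧
  (∀ u ∈ S, ∀ v ∈ S, T.Backward θ u v → u = c)

/-- `S` with center `c` is a left star of `T` under `θ`. -/
def IsLeftStarAt (T : Tournament n) (θ : Equiv.Perm (Fin n)) (S : Finset (Fin n))
    (c : Fin n) : Prop :=
  c ∈ S ∧ (S.erase c).Nonempty ∧
  (∀ v ∈ S.erase c, pos θ c < pos θ v ∧ T.adj v c) ∧
  (∀ u ∈ S, ∀ v ∈ S, T.Backward θ u v → v = c)

/-- `S` with center `c` is a middle star of `T` under `θ`. -/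
def IsMiddleStarAt (T : Tournament n) (θ : Equiv.Perm (Fin n)) (S : Finset (Fin n))
    (c : Fin n) : Prop :=
  c ∈ S ∧
  (∃ v ∈ S.erase c, pos θ v < pos θ c) ∧ (∃ v ∈ S.erase c, pos θ c < pos θ v) ∧
  (∀ v ∈ S.erase c, (pos θ v < pos θ c → T.adj c v) ∧ (pos θ c < pos θ v → T.adj v c)) ∧
  (∀ u ∈ S, ∀ v ∈ S, T.Backward θ u v → u = c ∨ v = c)

def IsFrontierStarAt (T : Tournament n) (θ : Equiv.Perm (Fin n)) (S : Finset (Fin n))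
    (c : Fin n) : Prop :=
  T.IsLeftStarAt θ S c ∨ T.IsRightStarAt θ S c

def IsStarAt (T : Tournament n) (θ : Equiv.Perm (Fin n)) (S : Finset (Fin n))
    (c : Fin n) : Prop :=
  T.IsLeftStarAt θ S c ∨ T.IsRightStarAt θ S c ∨ T.IsMiddleStarAt θ S c

/-- A middle star with exactly one leaf after the center (center is `u_{p-1}`). -/
def IsOneRightMiddleStarAt (T : Tournament n) (θ : Equiv.Perm (Fin n)) (S : Finset (Fin n))
    (c : Fin n) : Prop :=
  T.IsMiddleStarAt θ S c ∧ ((S.erase c).filter (fun v => pos θ c < pos θ v)).card = 1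

/-- A middle star with exactly one leaf before the center (center is `u_2`). -/
def IsOneLeftMiddleStarAt (T : Tournament n) (θ : Equiv.Perm (Fin n)) (S : Finset (Fin n))
    (c : Fin n) : Prop :=
  T.IsMiddleStarAt θ S c ∧ ((S.erase c).filter (fun v => pos θ v < pos θ c)).card = 1

/-- Kinds of super 2-nebulas. -/
inductive NebKind
  | left
  | middle
  | right

/-- Common requirements on the data of a super 2-nebula: vertex set `S`, centers `c₁, c₂`
(`c₁` before `c₂` under `θ`), leaves `L₁` incident to `c₁` and `L₂` incident to `c₂`. -/
def Super2NebCommon (θ : Equiv.Perm (Fin n)) (S : Finset (Fin n)) (c₁ c₂ : Fin n)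
    (L₁ L₂ : Finset (Fin n)) : Prop :=
  L₁.Nonempty ∧ L₂.Nonempty ∧ Disjoint L₁ L₂ ∧
  c₁ ∉ L₁ ∪ L₂ ∧ c₂ ∉ L₁ ∪ L₂ ∧ c₁ ≠ c₂ ∧
  S = insert c₁ (insert c₂ (L₁ ∪ L₂)) ∧ pos θ c₁ < pos θ c₂

/-- `S` is a super (left/middle/right) 2-nebula of `T` under `θ`, with centers `c₁, c₂` and
leaves `L₁` (incident to `c₁`) and `L₂` (incident to `c₂`). -/
def IsSuper2NebulaAt (T : Tournament n) (θ : Equiv.Perm (Fin n)) (S : Finset (Fin n))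
    (c₁ c₂ : Fin n) (L₁ L₂ : Finset (Fin n)) : NebKind → Prop
  | NebKind.middle =>
      Super2NebCommon θ S c₁ c₂ L₁ L₂ ∧
      (∀ v ∈ L₁ ∪ L₂, pos θ c₁ < pos θ v ∧ pos θ v < pos θ c₂) ∧
      (∀ v ∈ L₁, T.adj v c₁) ∧ (∀ v ∈ L₂, T.adj c₂ v) ∧ T.adj c₂ c₁ ∧
      (∀ u ∈ S, ∀ v ∈ S, T.Backward θ u v →
        (u ∈ L₁ ∧ v = c₁) ∨ (u = c₂ ∧ v ∈ L₂) ∨ (u = c₂ ∧ v = c₁))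
  | NebKind.left =>
      Super2NebCommon θ S c₁ c₂ L₁ L₂ ∧
      (∀ v ∈ L₁ ∪ L₂, pos θ v < pos θ c₁) ∧
      (∀ v ∈ L₁, T.adj c₁ v) ∧ (∀ v ∈ L₂, T.adj c₂ v) ∧ T.adj c₂ c₁ ∧
      (∀ u ∈ S, ∀ v ∈ S, T.Backward θ u v →
        (u = c₁ ∧ v ∈ L₁) ∨ (u = c₂ ∧ v ∈ L₂) ∨ (u = c₂ ∧ v = c₁))
  | NebKind.right =>
      Super2NebCommon θ S c₁ c₂ L₁ L₂ ∧
      (∀ v ∈ L₁ ∪ L₂, pos θ c₂ < pos θ v) ∧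
      (∀ v ∈ L₁, T.adj v c₁) ∧ (∀ v ∈ L₂, T.adj v c₂) ∧ T.adj c₂ c₁ ∧
      (∀ u ∈ S, ∀ v ∈ S, T.Backward θ u v →
        (u ∈ L₁ ∧ v = c₁) ∨ (u ∈ L₂ ∧ v = c₂) ∨ (u = c₂ ∧ v = c₁))

/-- A decomposition of `T` witnessing that `T` is a super nebula under `θ`, with stars
`Q i` (centers `ctr i`) and super 2-nebulas `Sig i` (centers `c₁ i, c₂ i`, leaves
`L₁ i, L₂ i`, of kind `kd i`). -/
def SuperNebulaDecomp (T : Tournament n) (θ : Equiv.Perm (Fin n)) {m l : ℕ}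
    (Q : Fin m → Finset (Fin n)) (ctr : Fin m → Fin n)
    (Sig : Fin l → Finset (Fin n)) (c₁ c₂ : Fin l → Fin n)
    (L₁ L₂ : Fin l → Finset (Fin n)) (kd : Fin l → NebKind) : Prop :=
  (∀ i, T.IsStarAt θ (Q i) (ctr i)) ∧
  (∀ i, T.IsSuper2NebulaAt θ (Sig i) (c₁ i) (c₂ i) (L₁ i) (L₂ i) (kd i)) ∧
  (∀ i j, i ≠ j → Disjoint (Q i) (Q j)) ∧
  (∀ i j, i ≠ j → Disjoint (Sig i) (Sig j)) ∧
  (∀ i j, Disjoint (Q i) (Sig j)) ∧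
  (∀ u v, T.Backward θ u v → (∃ i, u ∈ Q i ∧ v ∈ Q i) ∨ (∃ i, u ∈ Sig i ∧ v ∈ Sig i)) ∧
  (∀ i j, ¬ BetweenSet θ (L₁ j ∪ L₂ j) (ctr i)) ∧
  (∀ i j, i ≠ j → ¬ BetweenSet θ (L₁ j ∪ L₂ j) (c₁ i) ∧ ¬ BetweenSet θ (L₁ j ∪ L₂ j) (c₂ i))

/-- `T` is a super nebula. -/
def IsSuperNebula (T : Tournament n) : Prop :=
  ∃ (θ : Equiv.Perm (Fin n)) (m l : ℕ) (Q : Fin m → Finset (Fin n)) (ctr : Fin m → Fin n)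
    (Sig : Fin l → Finset (Fin n)) (c₁ c₂ : Fin l → Fin n)
    (L₁ L₂ : Fin l → Finset (Fin n)) (kd : Fin l → NebKind),
    SuperNebulaDecomp T θ Q ctr Sig c₁ c₂ L₁ L₂ kd

/-- `{a, b, c}` (in this position order) is a triangle of `T` under `θ`:
`a` is the left exterior, `b` the center, `c` the right exterior. -/
def IsTriangleAt (T : Tournament n) (θ : Equiv.Perm (Fin n)) (a b c : Fin n) : Prop :=
  pos θ a < pos θ b ∧ pos θ b < pos θ c ∧ T.adj b a ∧ T.adj c a ∧ T.adj c b

/-- A decomposition of `T` under `θ` into triangles `{A i, B i, C i}` (left exterior, center,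
right exterior) and frontier stars `Q j` with centers `ctr j`, where for each triangle `i`,
the vertices in `forb i` are not allowed to lie between leaves of a star. -/
def TriGalaxyDecomp (T : Tournament n) (θ : Equiv.Perm (Fin n)) {l k : ℕ}
    (A B C : Fin l → Fin n) (Q : Fin k → Finset (Fin n)) (ctr : Fin k → Fin n)
    (forb : Fin l → Finset (Fin n)) : Prop :=
  (∀ i, T.IsTriangleAt θ (A i) (B i) (C i)) ∧
  (∀ j, T.IsFrontierStarAt θ (Q j) (ctr j)) ∧
  (∀ i j, i ≠ j →
    Disjoint ({A i, B i, C i} : Finset (Fin n)) ({A j, B j, C j} : Finset (Fin n))) ∧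
  (∀ i j, Disjoint ({A i, B i, C i} : Finset (Fin n)) (Q j)) ∧
  (∀ i j, i ≠ j → Disjoint (Q i) (Q j)) ∧
  (∀ u v, T.Backward θ u v →
    (∃ i, u ∈ ({A i, B i, C i} : Finset (Fin n)) ∧ v ∈ ({A i, B i, C i} : Finset (Fin n))) ∨
    (∃ j, u ∈ Q j ∧ v ∈ Q j)) ∧
  (∀ i j, i ≠ j → ¬ BetweenSet θ ((Q j).erase (ctr j)) (ctr i)) ∧
  (∀ i j, ∀ x ∈ forb i, ¬ BetweenSet θ ((Q j).erase (ctr j)) x)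

/-- `T` is a Δgalaxy: a triangular galaxy with exactly one triangle. -/
def IsDeltaGalaxy (T : Tournament n) : Prop :=
  ∃ (θ : Equiv.Perm (Fin n)) (a b c : Fin n) (k : ℕ)
    (Q : Fin k → Finset (Fin n)) (ctr : Fin k → Fin n),
    TriGalaxyDecomp T θ (fun _ : Fin 1 => a) (fun _ => b) (fun _ => c) Q ctr
      (fun _ => ({a, b, c} : Finset (Fin n)))

/-- `T` is a central triangular galaxy: centers of triangles may lie between leaves of stars. -/
def IsCentralTriangularGalaxy (T : Tournament n) : Prop :=
  ∃ (θ : Equiv.Perm (Fin n)) (l k : ℕ) (A B C : Fin l → Fin n)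
    (Q : Fin k → Finset (Fin n)) (ctr : Fin k → Fin n),
    TriGalaxyDecomp T θ A B C Q ctr (fun i => ({A i, C i} : Finset (Fin n)))

/-- `T` is a left triangular galaxy: left exteriors of triangles may lie between leaves. -/
def IsLeftTriangularGalaxy (T : Tournament n) : Prop :=
  ∃ (θ : Equiv.Perm (Fin n)) (l k : ℕ) (A B C : Fin l → Fin n)
    (Q : Fin k → Finset (Fin n)) (ctr : Fin k → Fin n),
    TriGalaxyDecomp T θ A B C Q ctr (fun i => ({B i, C i} : Finset (Fin n)))

/-- `T` is a right triangular galaxy: right exteriors of triangles may lie between leaves. -/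
def IsRightTriangularGalaxy (T : Tournament n) : Prop :=
  ∃ (θ : Equiv.Perm (Fin n)) (l k : ℕ) (A B C : Fin l → Fin n)
    (Q : Fin k → Finset (Fin n)) (ctr : Fin k → Fin n),
    TriGalaxyDecomp T θ A B C Q ctr (fun i => ({A i, B i} : Finset (Fin n)))

/-- A decomposition of `T` witnessing that `T` is a nebula under `θ` (no condition on the
location of the centers of the stars). -/
def NebulaDecomp (T : Tournament n) (θ : Equiv.Perm (Fin n)) {k : ℕ}
    (Q : Fin k → Finset (Fin n)) (ctr : Fin k → Fin n) : Prop :=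
  (∀ i, T.IsStarAt θ (Q i) (ctr i)) ∧
  (∀ i j, i ≠ j → Disjoint (Q i) (Q j)) ∧
  (∀ u v, T.Backward θ u v → ∃ i, u ∈ Q i ∧ v ∈ Q i)

/-- `T` is a central nebula: a nebula all of whose stars are 3-vertex middle stars. -/
def IsCentralNebula (T : Tournament n) : Prop :=
  ∃ (θ : Equiv.Perm (Fin n)) (k : ℕ) (Q : Fin k → Finset (Fin n)) (ctr : Fin k → Fin n),
    NebulaDecomp T θ Q ctr ∧ ∀ i, T.IsMiddleStarAt θ (Q i) (ctr i) ∧ (Q i).card = 3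

/-- `T` is a super left nebula: a nebula all of whose stars are left stars. -/
def IsSuperLeftNebula (T : Tournament n) : Prop :=
  ∃ (θ : Equiv.Perm (Fin n)) (k : ℕ) (Q : Fin k → Finset (Fin n)) (ctr : Fin k → Fin n),
    NebulaDecomp T θ Q ctr ∧ ∀ i, T.IsLeftStarAt θ (Q i) (ctr i)

/-- `T` is a super right nebula: a nebula all of whose stars are right stars. -/
def IsSuperRightNebula (T : Tournament n) : Prop :=
  ∃ (θ : Equiv.Perm (Fin n)) (k : ℕ) (Q : Fin k → Finset (Fin n)) (ctr : Fin k → Fin n),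
    NebulaDecomp T θ Q ctr ∧ ∀ i, T.IsRightStarAt θ (Q i) (ctr i)

/-- `T` is an LR-Δgalaxy: a super Δgalaxy in which only the two exteriors of the triangle
may lie between leaves of a star. -/
def IsLRDeltaGalaxy (T : Tournament n) : Prop :=
  ∃ (θ : Equiv.Perm (Fin n)) (a b c : Fin n) (k : ℕ)
    (Q : Fin k → Finset (Fin n)) (ctr : Fin k → Fin n),
    TriGalaxyDecomp T θ (fun _ : Fin 1 => a) (fun _ => b) (fun _ => c) Q ctr
      (fun _ => ({b} : Finset (Fin n)))

/-- `T` is a CR-Δgalaxy. -/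
def IsCRDeltaGalaxy (T : Tournament n) : Prop :=
  ∃ (θ : Equiv.Perm (Fin n)) (a b c : Fin n) (k : ℕ)
    (Q : Fin k → Finset (Fin n)) (ctr : Fin k → Fin n),
    TriGalaxyDecomp T θ (fun _ : Fin 1 => a) (fun _ => b) (fun _ => c) Q ctr
      (fun _ => ({a} : Finset (Fin n))) ∧
    (∀ i j, i ≠ j → BetweenSet θ ((Q i).erase (ctr i)) b →
      BetweenSet θ ((Q j).erase (ctr j)) c →
      (∀ x ∈ (Q i).erase (ctr i), ¬ BetweenSet θ ((Q j).erase (ctr j)) x) ∧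
      (∀ x ∈ (Q j).erase (ctr j), ¬ BetweenSet θ ((Q i).erase (ctr i)) x)) ∧
    (∀ i, BetweenSet θ ((Q i).erase (ctr i)) b → ¬ BetweenSet θ ((Q i).erase (ctr i)) c)

/-- `T` is a CL-Δgalaxy. -/
def IsCLDeltaGalaxy (T : Tournament n) : Prop :=
  ∃ (θ : Equiv.Perm (Fin n)) (a b c : Fin n) (k : ℕ)
    (Q : Fin k → Finset (Fin n)) (ctr : Fin k → Fin n),
    TriGalaxyDecomp T θ (fun _ : Fin 1 => a) (fun _ => b) (fun _ => c) Q ctr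
      (fun _ => ({c} : Finset (Fin n))) ∧
    (∀ i j, i ≠ j → BetweenSet θ ((Q i).erase (ctr i)) b →
      BetweenSet θ ((Q j).erase (ctr j)) a →
      (∀ x ∈ (Q i).erase (ctr i), ¬ BetweenSet θ ((Q j).erase (ctr j)) x) ∧
      (∀ x ∈ (Q j).erase (ctr j), ¬ BetweenSet θ ((Q i).erase (ctr i)) x)) ∧
    (∀ i, BetweenSet θ ((Q i).erase (ctr i)) b → ¬ BetweenSet θ ((Q i).erase (ctr i)) a)

/-- A decomposition of `T` under `θ` into one super 2-nebula (of kind `kd`) and frontier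
stars, covering all of `V(T)`, witnessing that `T` is a Σ-galaxy under `θ`. -/
def SigmaGalaxyDecomp (T : Tournament n) (θ : Equiv.Perm (Fin n))
    (S : Finset (Fin n)) (c₁ c₂ : Fin n) (L₁ L₂ : Finset (Fin n)) (kd : NebKind)
    {m : ℕ} (Q : Fin m → Finset (Fin n)) (ctr : Fin m → Fin n) : Prop :=
  T.IsSuper2NebulaAt θ S c₁ c₂ L₁ L₂ kd ∧
  (∀ j, T.IsFrontierStarAt θ (Q j) (ctr j)) ∧
  (∀ i j, i ≠ j → Disjoint (Q i) (Q j)) ∧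
  (∀ j, Disjoint S (Q j)) ∧
  (∀ v, v ∈ S ∨ ∃ j, v ∈ Q j) ∧
  (∀ u v, T.Backward θ u v → (u ∈ S ∧ v ∈ S) ∨ ∃ j, u ∈ Q j ∧ v ∈ Q j) ∧
  (∀ j, ¬ BetweenSet θ (L₁ ∪ L₂) (ctr j)) ∧
  (∀ j, ¬ BetweenSet θ ((Q j).erase (ctr j)) c₁ ∧ ¬ BetweenSet θ ((Q j).erase (ctr j)) c₂) ∧
  (∀ i j, i ≠ j → ¬ BetweenSet θ ((Q j).erase (ctr j)) (ctr i))

def IsMiddleSigmaGalaxy (T : Tournament n) : Prop :=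
  ∃ (θ : Equiv.Perm (Fin n)) (S : Finset (Fin n)) (c₁ c₂ : Fin n) (L₁ L₂ : Finset (Fin n))
    (m : ℕ) (Q : Fin m → Finset (Fin n)) (ctr : Fin m → Fin n),
    SigmaGalaxyDecomp T θ S c₁ c₂ L₁ L₂ NebKind.middle Q ctr

def IsLeftSigmaGalaxy (T : Tournament n) : Prop :=
  ∃ (θ : Equiv.Perm (Fin n)) (S : Finset (Fin n)) (c₁ c₂ : Fin n) (L₁ L₂ : Finset (Fin n))
    (m : ℕ) (Q : Fin m → Finset (Fin n)) (ctr : Fin m → Fin n),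
    SigmaGalaxyDecomp T θ S c₁ c₂ L₁ L₂ NebKind.left Q ctr

def IsRightSigmaGalaxy (T : Tournament n) : Prop :=
  ∃ (θ : Equiv.Perm (Fin n)) (S : Finset (Fin n)) (c₁ c₂ : Fin n) (L₁ L₂ : Finset (Fin n))
    (m : ℕ) (Q : Fin m → Finset (Fin n)) (ctr : Fin m → Fin n),
    SigmaGalaxyDecomp T θ S c₁ c₂ L₁ L₂ NebKind.right Q ctr

/-- The directed density from `X` to `Y`. -/
noncomputable def density (T : Tournament n) (X Y : Finset (Fin n)) : ℝ :=
  (Set.ncard {p : Fin n × Fin n | p.1 ∈ X ∧ p.2 ∈ Y ∧ T.adj p.1 p.2} : ℝ) /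
    ((X.card : ℝ) * (Y.card : ℝ))

/-- `(S i)` is a smooth `(c, lam, w)`-structure of `T`. -/
def IsSmoothStructure (T : Tournament n) (c lam : ℝ) {N : ℕ} (w : Fin N → Bool)
    (S : Fin N → Finset (Fin n)) : Prop :=
  (∀ i j, i ≠ j → Disjoint (S i) (S j)) ∧
  (∀ i, w i = false → c * (n : ℝ) ≤ ((S i).card : ℝ)) ∧
  (∀ i, w i = true → T.IsTransOn (S i) ∧ c * (T.trSize : ℝ) ≤ ((S i).card : ℝ)) ∧
  (∀ i j, i < j →
    (∀ v ∈ S i, 1 - lam ≤ T.density {v} (S j)) ∧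
    (∀ v ∈ S j, 1 - lam ≤ T.density (S i) {v}))

end Tournament

/-- The backward arcs of `K₆` under its canonical ordering. -/
def K6back : List (ℕ × ℕ) := [(3, 0), (5, 2), (5, 0), (4, 1)]

/-- The tournament `K₆`, on `Fin 6` with its canonical ordering. -/
def K6 : Tournament 6 where
  adj u v := (u.val, v.val) ∈ K6back ∨ (u < v ∧ (v.val, u.val) ∉ K6back)
  asymm := by decide
  total := by decide

/-- The pair `{H₁, H₂}` satisfies the Erdős–Hajnal conjecture: there is `ε > 0` such that
every `{H₁, H₂}`-free tournament `T` has a transitive subtournament of size `≥ |T| ^ ε`. -/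
def EHPair {n₁ n₂ : ℕ} (H₁ : Tournament n₁) (H₂ : Tournament n₂) : Prop :=
  ∃ ε : ℝ, 0 < ε ∧ ∀ (n : ℕ) (T : Tournament n),
    ¬ T.Contains H₁ → ¬ T.Contains H₂ → (n : ℝ) ^ ε ≤ (T.trSize : ℝ)

namespace Tournament

section ErdosHajnal

open scoped Classical

variable {N : ℕ}

theorem irrefl (T : Tournament N) (v : Fin N) : ¬ T.adj v v := fun h => T.asymm v v h h

theorem IsTransOn.mono {T : Tournament N} {s t : Finset (Fin N)} (h : T.IsTransOn t)
    (hst : s ⊆ t) : T.IsTransOn s :=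
  fun u hu v hv w hw => h u (hst hu) v (hst hv) w (hst hw)

theorem bddAbove_trans (T : Tournament N) (s : Finset (Fin N)) :
    BddAbove {k | ∃ t, t ⊆ s ∧ T.IsTransOn t ∧ t.card = k} :=
  ⟨#s, by rintro k ⟨t, hts, -, rfl⟩; exact card_le_card hts⟩

theorem card_le_trSizeOn {T : Tournament N} {s t : Finset (Fin N)} (hts : t ⊆ s)
    (ht : T.IsTransOn t) : #t ≤ T.trSizeOn s :=
  le_csSup (T.bddAbove_trans s) ⟨t, hts, ht, rfl⟩

theorem exists_card_eq_trSizeOn (T : Tournament N) (s : Finset (Fin N)) :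
    ∃ t ⊆ s, T.IsTransOn t ∧ #t = T.trSizeOn s := by
  have hne : {k | ∃ t, t ⊆ s ∧ T.IsTransOn t ∧ t.card = k}.Nonempty :=
    ⟨0, ∅, empty_subset _, fun u hu => by simp at hu, rfl⟩
  obtain ⟨t, h1, h2, h3⟩ := Nat.sSup_mem hne (T.bddAbove_trans s)
  exact ⟨t, h1, h2, h3⟩

theorem IsTransOn.union {T : Tournament N} {s t : Finset (Fin N)} (hs : T.IsTransOn s)
    (ht : T.IsTransOn t) (hst : ∀ u ∈ s, ∀ v ∈ t, T.adj u v) : T.IsTransOn (s ∪ t) := by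
  intro u hu v hv w hw huv hvw
  rw [mem_union] at hu hv hw
  rcases hu with hu | hu <;> rcases hv with hv | hv <;> rcases hw with hw | hw
  · exact hs u hu v hv w hw huv hvw
  · exact hst u hu w hw
  · exact absurd hvw (T.asymm _ _ (hst w hw v hv))
  · exact hst u hu w hw
  · exact absurd huv (T.asymm _ _ (hst v hv u hu))
  · exact absurd huv (T.asymm _ _ (hst v hv u hu))
  · exact absurd hvw (T.asymm _ _ (hst w hw v hv))
  · exact ht u hu v hv w hw huv hvw

theorem trSizeOn_add_le {T : Tournament N} {s t : Finset (Fin N)}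
    (hst : ∀ u ∈ s, ∀ v ∈ t, T.adj u v) : T.trSizeOn s + T.trSizeOn t ≤ T.trSize := by
  obtain ⟨s', hs', hs, hsc⟩ := T.exists_card_eq_trSizeOn s
  obtain ⟨t', ht', ht, htc⟩ := T.exists_card_eq_trSizeOn t
  have hadj_st : ∀ u ∈ s', ∀ v ∈ t', T.adj u v := fun u hu v hv => hst u (hs' hu) v (ht' hv)
  have hdisj : Disjoint s' t' :=
    disjoint_left.2 fun u hu hu' => T.irrefl u (hadj_st u hu u hu')
  rw [← hsc, ← htc, ← card_union_of_disjoint hdisj]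
  exact card_le_trSizeOn (subset_univ _) (hs.union ht hadj_st)

/-- Every tournament on `2 ^ k` vertices has a transitive subtournament on `k + 1` vertices. -/
theorem lt_trSizeOn_of_two_pow_le (T : Tournament N) (k : ℕ) (s : Finset (Fin N))
    (hs : 2 ^ k ≤ #s) : k < T.trSizeOn s := by
  induction k generalizing s with
  | zero =>
    obtain ⟨v, hv⟩ := card_pos.1 (by simpa using hs)
    have := card_le_trSizeOn (T := T) (singleton_subset_iff.2 hv)
      (by intro a ha b hb c hc hab; simp_all)
    simpa [Nat.succ_le_iff] using this
  | succ k ih =>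
    obtain ⟨v, hv⟩ := card_pos.1 (lt_of_lt_of_le (by positivity) hs)
    have hv1 : T.IsTransOn {v} := by intro a ha b hb c hc hab; simp_all
    have key : ∀ t ⊆ s.erase v,
        ((∀ u ∈ t, T.adj v u) ∨ ∀ u ∈ t, T.adj u v) → 2 ^ k ≤ #t → k + 1 < T.trSizeOn s := by
      intro t hts ht hk
      have hvt : v ∉ t := fun h => by simpa using hts h
      obtain ⟨t', ht', htr, htc⟩ := T.exists_card_eq_trSizeOn t
      have h1 := ih t hk
      have h2 : T.IsTransOn (insert v t') := by
        rcases ht with ht | ht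
        · rw [insert_eq]
          exact hv1.union htr fun u hu w hw => by
            rw [mem_singleton.1 hu]; exact ht w (ht' hw)
        · rw [insert_eq, union_comm]
          exact htr.union hv1 fun u hu w hw => by
            rw [mem_singleton.1 hw]; exact ht u (ht' hu)
      have h3 := card_le_trSizeOn (s := s)
        (insert_subset hv ((ht'.trans hts).trans (erase_subset _ _))) h2
      rw [card_insert_of_notMem (fun h => hvt (ht' h))] at h3
      omega
    have hsplit := card_filter_add_card_filter_not (s := s.erase v) (fun u => T.adj v u)
    rw [card_erase_of_mem hv] at hsplit
    rw [pow_succ] at hs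
    by_cases h : 2 ^ k ≤ #{u ∈ s.erase v | T.adj v u}
    · exact key _ (filter_subset _ _) (Or.inl fun u hu => (mem_filter.1 hu).2) h
    · refine key _ (filter_subset (fun u => ¬ T.adj v u) _) (Or.inr fun u hu => ?_) (by omega)
      rw [mem_filter, mem_erase] at hu
      exact (T.total u v hu.1.1).resolve_right hu.2

/-- A transitive set splits into consecutive blocks, `p` of which have size `#S / p`. -/
theorem IsTransOn.exists_blocks {T : Tournament N} {S : Finset (Fin N)} (hS : T.IsTransOn S)
    (p : ℕ) : ∃ P : ℕ → Finset (Fin N), (∀ i, P i ⊆ S) ∧ (∀ i < p, #(P i) = #S / p) ∧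
      ∀ i j, i < j → ∀ x ∈ P i, ∀ y ∈ P j, T.adj x y := by
  set rank : Fin N → ℕ := fun v => #{u ∈ S | T.adj u v} with hrank
  have hlt : ∀ u ∈ S, ∀ v ∈ S, T.adj u v → rank u < rank v := by
    intro u hu v hv huv
    refine card_lt_card ⟨fun w hw => ?_, fun h => ?_⟩
    · rw [mem_filter] at hw ⊢
      exact ⟨hw.1, hS w hw.1 u hu v hv hw.2 huv⟩
    · exact T.irrefl u (mem_filter.1 (h (mem_filter.2 ⟨hu, huv⟩))).2
  have hinj : Set.InjOn rank S := by
    intro u hu v hv huv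
    by_contra hne
    rcases T.total u v hne with h | h
    · exact (hlt u hu v hv h).ne huv
    · exact (hlt v hv u hu h).ne huv.symm
  have hmaps : S.image rank ⊆ range #S := by
    intro k hk
    obtain ⟨v, hv, rfl⟩ := mem_image.1 hk
    refine mem_range.2 (card_lt_card ⟨filter_subset _ _, fun h => ?_⟩)
    exact T.irrefl v (mem_filter.1 (h hv)).2
  have himage : S.image rank = range #S :=
    eq_of_subset_of_card_le hmaps (by rw [card_range, card_image_of_injOn hinj])
  set q := #S / p with hq
  refine ⟨fun i => {v ∈ S | i * q ≤ rank v ∧ rank v < (i + 1) * q}, fun i => filter_subset _ _,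
    fun i hi => ?_, fun i j hij x hx y hy => ?_⟩
  · have h1 : ({v ∈ S | i * q ≤ rank v ∧ rank v < (i + 1) * q}.image rank) =
        Ico (i * q) ((i + 1) * q) := by
      ext k
      simp only [mem_image, mem_filter, mem_Ico]
      constructor
      · rintro ⟨v, ⟨-, hv⟩, rfl⟩
        exact hv
      · intro hk
        have hle : (i + 1) * q ≤ #S := (Nat.mul_le_mul_right q hi).trans (Nat.mul_div_le _ _)
        have : k ∈ S.image rank := by rw [himage, mem_range]; omega
        obtain ⟨v, hv, rfl⟩ := mem_image.1 this
        exact ⟨v, ⟨hv, hk⟩, rfl⟩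
    rw [← card_image_of_injOn (hinj.mono (coe_subset.2 (filter_subset _ _))), h1, Nat.card_Ico,
      add_mul, one_mul, Nat.add_sub_cancel_left]
  · rw [mem_filter] at hx hy
    have h1 : (i + 1) * q ≤ j * q := Nat.mul_le_mul_right q hij
    have h2 : rank x < rank y := by omega
    have hne : x ≠ y := by rintro rfl; exact lt_irrefl _ h2
    exact (T.total x y hne).resolve_right fun h => (hlt y hy.1 x hx.1 h).not_gt h2

/-- The tournament on `Fin N` given by the natural order. -/
def transitive (N : ℕ) : Tournament N where
  adj u v := u < v
  asymm _ _ h := h.not_gt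
  total _ _ h := lt_or_gt_of_ne h

theorem exists_equal_parts (s : Finset (Fin N)) (p : ℕ) :
    ∃ P : ℕ → Finset (Fin N), (∀ i, P i ⊆ s) ∧ (∀ i < p, #(P i) = #s / p) ∧
      ∀ i j, i ≠ j → Disjoint (P i) (P j) := by
  have hs : (transitive N).IsTransOn s := fun u _ v _ w _ h1 h2 => lt_trans h1 h2
  obtain ⟨P, h1, h2, h3⟩ := hs.exists_blocks p
  refine ⟨P, h1, h2, fun i j hij => disjoint_left.2 fun x hx hy => ?_⟩
  rcases lt_or_gt_of_ne hij with h | h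
  · exact (transitive N).irrefl x (h3 i j h x hx x hy)
  · exact (transitive N).irrefl x (h3 j i h x hy x hx)

/-- All but a `lam` fraction of the arcs at each vertex lead from `X` to `Y`. -/
def AlmostComplete (T : Tournament N) (lam : ℝ) (X Y : Finset (Fin N)) : Prop :=
  (∀ x ∈ X, (#{y ∈ Y | T.adj y x} : ℝ) ≤ lam * #Y) ∧
  ∀ y ∈ Y, (#{x ∈ X | T.adj y x} : ℝ) ≤ lam * #X

theorem AlmostComplete.shrink {T : Tournament N} {lam R lam' : ℝ} {X Y X' Y' : Finset (Fin N)}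
    (h : T.AlmostComplete lam X Y) (hlam : 0 ≤ lam) (hX : X' ⊆ X) (hY : Y' ⊆ Y)
    (hXc : (#X : ℝ) ≤ R * #X') (hYc : (#Y : ℝ) ≤ R * #Y') (hR : lam * R ≤ lam') :
    T.AlmostComplete lam' X' Y' := by
  have aux : ∀ (A A' : Finset (Fin N)) (P : Fin N → Prop), A' ⊆ A → (#A : ℝ) ≤ R * #A' →
      (#{a ∈ A | P a} : ℝ) ≤ lam * #A → (#{a ∈ A' | P a} : ℝ) ≤ lam' * #A' := by
    intro A A' P hA hAc hP
    calc (#{a ∈ A' | P a} : ℝ) ≤ #{a ∈ A | P a} :=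
          Nat.cast_le.2 (card_le_card (filter_subset_filter _ hA))
      _ ≤ lam * #A := hP
      _ ≤ lam * (R * #A') := mul_le_mul_of_nonneg_left hAc hlam
      _ = lam * R * #A' := by ring
      _ ≤ lam' * #A' := mul_le_mul_of_nonneg_right hR (Nat.cast_nonneg _)
  exact ⟨fun x hx => aux _ _ _ hY hYc (h.1 x (hX hx)),
    fun y hy => aux _ _ _ hX hXc (h.2 y (hY hy))⟩

theorem card_le_two_mul_card_filter {α β : Type*} (r : α → β → Prop) (X : Finset α) (Y : Finset β)
    {lam : ℝ} (hlam : 0 < lam) (h : ∀ y ∈ Y, (#{x ∈ X | r x y} : ℝ) ≤ lam * #X) :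
    (#X : ℝ) ≤ 2 * #{x ∈ X | (#{y ∈ Y | r x y} : ℝ) ≤ 2 * lam * #Y} := by
  rcases Y.eq_empty_or_nonempty with rfl | hY
  · simp [two_mul]
  have hY0 : (0 : ℝ) < #Y := Nat.cast_pos.2 hY.card_pos
  set B := {x ∈ X | ¬ (#{y ∈ Y | r x y} : ℝ) ≤ 2 * lam * #Y} with hB
  have hsum : (∑ x ∈ X, (#{y ∈ Y | r x y} : ℝ)) = ∑ y ∈ Y, (#{x ∈ X | r x y} : ℝ) := by
    exact_mod_cast sum_card_bipartiteAbove_eq_sum_card_bipartiteBelow r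
  have h1 : (#B : ℝ) * (2 * lam * #Y) ≤ ∑ x ∈ X, (#{y ∈ Y | r x y} : ℝ) := by
    calc (#B : ℝ) * (2 * lam * #Y) = ∑ x ∈ B, (2 * lam * #Y) := by simp
      _ ≤ ∑ x ∈ B, (#{y ∈ Y | r x y} : ℝ) :=
          sum_le_sum fun x hx => (not_le.1 (mem_filter.1 hx).2).le
      _ ≤ _ := sum_le_sum_of_subset_of_nonneg (filter_subset _ _)
          fun _ _ _ => Nat.cast_nonneg _
  have h2 : ∑ y ∈ Y, (#{x ∈ X | r x y} : ℝ) ≤ #Y * (lam * #X) := by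
    calc _ ≤ ∑ y ∈ Y, lam * #X := sum_le_sum h
      _ = _ := by simp
  have h3 : 2 * (#B : ℝ) ≤ #X := by
    have h4 : (2 * (#B : ℝ)) * (lam * #Y) ≤ #X * (lam * #Y) := by nlinarith
    exact le_of_mul_le_mul_right h4 (by positivity)
  have hsplit : (#{x ∈ X | (#{y ∈ Y | r x y} : ℝ) ≤ 2 * lam * #Y} : ℝ) + #B = #X := by
    exact_mod_cast card_filter_add_card_filter_not (s := X)
      (fun x => (#{y ∈ Y | r x y} : ℝ) ≤ 2 * lam * #Y)
  linarith

theorem contains_of_adj {n : ℕ} {T : Tournament N} {H : Tournament n} (f : Fin n → Fin N)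
    (hf : ∀ u v, H.adj u v → T.adj (f u) (f v)) : T.Contains H := by
  have hinj : Function.Injective f := by
    intro u v huv
    by_contra hne
    rcases H.total u v hne with h | h
    · exact T.irrefl _ (huv ▸ hf u v h)
    · exact T.irrefl _ (huv ▸ hf v u h)
  refine ⟨⟨f, hinj⟩, fun u v => ⟨hf u v, fun h => ?_⟩⟩
  have hne : u ≠ v := by rintro rfl; exact T.irrefl _ h
  exact (H.total u v hne).resolve_right fun hvu => T.asymm _ _ h (hf v u hvu)

/-- Greedy embedding of `H` in a set `s` without large sparse pairs. -/
theorem exists_partial_embedding {h : ℕ} (hN : Nonempty (Fin N)) (T : Tournament N)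
    (H : Tournament h) {s : Finset (Fin N)} {lam b : ℝ} (hlam : 0 < lam) (hlam1 : lam ≤ 1)
    (hb : 0 < b)
    (hs : ∀ r : Fin N → Fin N → Prop, (r = T.adj ∨ r = fun x y => T.adj y x) →
      ∀ X ⊆ s, ∀ Y ⊆ s, Disjoint X Y → b ≤ #X → b ≤ #Y →
        ∃ x ∈ X, lam * #Y < #{y ∈ Y | r x y})
    (I : Finset (Fin h)) (V : Fin h → Finset (Fin N)) (hVs : ∀ i ∈ I, V i ⊆ s)
    (hV : ∀ i ∈ I, ∀ j ∈ I, i ≠ j → Disjoint (V i) (V j))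
    (hVc : ∀ i ∈ I, (h + 1) * b ≤ lam ^ #I * #(V i)) :
    ∃ f : Fin h → Fin N, (∀ i ∈ I, f i ∈ V i) ∧
      ∀ i ∈ I, ∀ j ∈ I, H.adj i j → T.adj (f i) (f j) := by
  induction I using Finset.induction_on generalizing V with
  | empty =>
    exact ⟨fun _ => hN.some, by simp, by simp⟩
  | insert i I hi ih =>
    have hpow : ∀ k : ℕ, lam ^ k ≤ 1 := fun k => pow_le_one₀ hlam.le hlam1
    have hlarge : ∀ j ∈ insert i I, (h + 1) * b ≤ #(V j) := fun j hj =>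
      (hVc j hj).trans (mul_le_of_le_one_left (Nat.cast_nonneg _) (hpow _))
    have hb' : b ≤ (h + 1) * b := le_mul_of_one_le_left hb.le (by simp)
    set r : Fin h → Fin N → Fin N → Prop :=
      fun j => if H.adj i j then T.adj else fun x y => T.adj y x with hr
    set bad : Fin h → Finset (Fin N) :=
      fun j => {x ∈ V i | (#{y ∈ V j | r j x y} : ℝ) ≤ lam * #(V j)} with hbad
    have hii : i ∈ insert i I := mem_insert_self i I
    have hbadc : ∀ j ∈ I, (#(bad j) : ℝ) ≤ b := by
      intro j hj
      by_contra! hlt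
      have hji : j ∈ insert i I := mem_insert_of_mem hj
      have hne : i ≠ j := by rintro rfl; exact hi hj
      obtain ⟨x, hx, hx'⟩ := hs (r j) (by simp only [hr]; split_ifs <;> simp) (bad j)
        ((filter_subset _ _).trans (hVs i hii)) (V j) (hVs j hji)
        (disjoint_of_subset_left (filter_subset _ _) (hV i hii j hji hne)) hlt.le
        (hb'.trans (hlarge j hji))
      exact (mem_filter.1 hx).2.not_gt hx'
    obtain ⟨v, hv, hv'⟩ : ∃ v ∈ V i, v ∉ I.biUnion bad := by
      by_contra! hall
      have h1 : (#(V i) : ℝ) ≤ ∑ j ∈ I, (#(bad j) : ℝ) := by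
        exact_mod_cast (card_le_card hall).trans card_biUnion_le
      have h2 : ∑ j ∈ I, (#(bad j) : ℝ) ≤ #I * b := by
        simpa using sum_le_sum hbadc
      have h3 : (#I : ℝ) ≤ h := by
        exact_mod_cast (card_le_univ I).trans_eq (Fintype.card_fin h)
      have h4 := hlarge i hii
      nlinarith
    have hgood : ∀ j ∈ I, lam * #(V j) ≤ #{y ∈ V j | r j v y} := by
      intro j hj
      by_contra! hlt
      exact hv' (mem_biUnion.2 ⟨j, hj, mem_filter.2 ⟨hv, hlt.le⟩⟩)
    obtain ⟨f, hf, hfadj⟩ := ih (fun j => {y ∈ V j | r j v y})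
      (fun j hj => (filter_subset _ _).trans (hVs j (mem_insert_of_mem hj)))
      (fun j hj k hk hjk => disjoint_of_subset_left (filter_subset _ _)
        (disjoint_of_subset_right (filter_subset _ _)
          (hV j (mem_insert_of_mem hj) k (mem_insert_of_mem hk) hjk)))
      (fun j hj => by
        refine (hVc j (mem_insert_of_mem hj)).trans ?_
        rw [card_insert_of_notMem hi, pow_succ, mul_assoc]
        exact mul_le_mul_of_nonneg_left (hgood j hj) (by positivity))
    have hne : ∀ j ∈ I, j ≠ i := fun j hj h => hi (h ▸ hj)
    have hfr : ∀ j ∈ I, r j v (f j) := fun j hj => (mem_filter.1 (hf j hj)).2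
    refine ⟨Function.update f i v, fun j hj => ?_, fun j hj k hk hjk => ?_⟩
    · rcases mem_insert.1 hj with rfl | hj
      · simpa using hv
      · rw [Function.update_of_ne (hne j hj)]
        exact (mem_filter.1 (hf j hj)).1
    · rcases mem_insert.1 hj with rfl | hj' <;> rcases mem_insert.1 hk with rfl | hk'
      · exact absurd hjk (H.irrefl _)
      · rw [Function.update_self, Function.update_of_ne (hne k hk')]
        simpa [hr, hjk] using hfr k hk'
      · rw [Function.update_self, Function.update_of_ne (hne j hj')]
        simpa [hr, H.asymm _ _ hjk] using hfr j hj'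
      · rw [Function.update_of_ne (hne k hk'), Function.update_of_ne (hne j hj')]
        exact hfadj j hj' k hk' hjk

theorem le_two_mul_div {m p : ℕ} (hp : 0 < p) (hpm : p ≤ m) :
    (m : ℝ) ≤ 2 * p * (m / p : ℕ) := by
  have h1 : m < p * (m / p) + p := by
    have := Nat.div_add_mod m p
    have := Nat.mod_lt m hp
    omega
  have h2 : p * 1 ≤ p * (m / p) :=
    Nat.mul_le_mul_left p ((Nat.one_le_div_iff hp).2 hpm)
  have h3 : m ≤ 2 * (p * (m / p)) := by omega
  calc (m : ℝ) ≤ ((2 * (p * (m / p)) : ℕ) : ℝ) := Nat.cast_le.2 h3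
    _ = _ := by push_cast; ring

theorem exists_almostComplete_pair {h : ℕ} (H : Tournament h) {lam : ℝ} (hlam : 0 < lam) :
    ∃ c : ℝ, 0 < c ∧ ∀ (N : ℕ) (T : Tournament N), ¬ T.Contains H →
      ∀ s : Finset (Fin N), 1 ≤ c * #s → ∃ X ⊆ s, ∃ Y ⊆ s, Disjoint X Y ∧
        c * #s ≤ #X ∧ c * #s ≤ #Y ∧ T.AlmostComplete lam X Y := by
  set mu : ℝ := min lam 1 / 2 with hmu
  have hmu0 : 0 < mu := by positivity
  have hmu1 : mu ≤ 1 := by have := min_le_right lam 1; linarith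
  have hmul : 2 * mu ≤ lam := by have := min_le_left lam 1; linarith
  set c : ℝ := mu ^ h / (2 * (h + 1) ^ 2) with hc
  have hc0 : 0 < c := by positivity
  refine ⟨c / 2, by positivity, fun N T hT s hs => ?_⟩
  have hs0 : 0 < c * #s := by linarith
  have hsN : Nonempty (Fin N) := by
    have h1 : (0 : ℝ) < #s := pos_of_mul_pos_right hs0 hc0.le
    obtain ⟨v, -⟩ := card_pos.1 (Nat.cast_pos.1 h1)
    exact ⟨v⟩
  by_contra! hno
  apply hT
  have hsparse : ∀ r : Fin N → Fin N → Prop, (r = T.adj ∨ r = fun x y => T.adj y x) →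
      ∀ X ⊆ s, ∀ Y ⊆ s, Disjoint X Y → c * #s ≤ #X → c * #s ≤ #Y →
        ∃ x ∈ X, mu * #Y < #{y ∈ Y | r x y} := by
    intro r hr X hX Y hY hXY hXc hYc
    by_contra! hall
    set Y' := {y ∈ Y | (#{x ∈ X | r x y} : ℝ) ≤ 2 * mu * #X} with hY'
    have hYY : Y' ⊆ Y := filter_subset _ _
    have hYc' : (#Y : ℝ) ≤ 2 * #Y' := card_le_two_mul_card_filter (fun y x => r x y) Y X hmu0 hall
    have h1 : ∀ x ∈ X, (#{y ∈ Y' | r x y} : ℝ) ≤ lam * #Y' := by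
      intro x hx
      have h2 : (#{y ∈ Y' | r x y} : ℝ) ≤ #{y ∈ Y | r x y} :=
        Nat.cast_le.2 (card_le_card (filter_subset_filter _ hYY))
      have h3 := hall x hx
      have h4 : (0 : ℝ) ≤ #Y' := Nat.cast_nonneg _
      nlinarith
    have h2 : ∀ y ∈ Y', (#{x ∈ X | r x y} : ℝ) ≤ lam * #X := by
      intro y hy
      exact (mem_filter.1 hy).2.trans (mul_le_mul_of_nonneg_right hmul (Nat.cast_nonneg _))
    have hXY' : Disjoint X Y' := disjoint_of_subset_right hYY hXY
    rcases hr with rfl | rfl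
    · exact hno Y' (hYY.trans hY) X hX hXY'.symm (by linarith) (by linarith) ⟨h2, h1⟩
    · exact hno X hX Y' (hYY.trans hY) hXY' (by linarith) (by linarith) ⟨h1, h2⟩
  obtain ⟨P, hP1, hP2, hP3⟩ := exists_equal_parts s (h + 1)
  have hsize : ∀ i < h + 1, (h + 1) * (c * #s) ≤ mu ^ h * #(P i) := by
    intro i hi
    have hpow : mu ^ h ≤ 1 := pow_le_one₀ hmu0.le hmu1
    have hh : ((h + 1 : ℕ) : ℝ) ≤ #s := by
      have h1 : c ≤ 1 / (2 * (h + 1) ^ 2) := by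
        rw [hc]; gcongr
      have h2 : c / 2 * #s ≤ 1 / (2 * (h + 1) ^ 2) * #s := by
        refine mul_le_mul_of_nonneg_right ?_ (Nat.cast_nonneg _)
        linarith
      have h3 : (1 : ℝ) ≤ 1 / (2 * (h + 1) ^ 2) * #s := hs.trans h2
      rw [div_mul_eq_mul_div, one_mul, le_div_iff₀ (by positivity)] at h3
      push_cast
      nlinarith [(Nat.cast_nonneg h : (0 : ℝ) ≤ h)]
    have h1 := le_two_mul_div (Nat.succ_pos h) (Nat.cast_le.1 hh)
    rw [hP2 i hi]
    push_cast at h1 ⊢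
    calc (h + 1) * (c * #s) ≤ (h + 1) * (c * (2 * (h + 1) * ((#s / (h + 1) : ℕ) : ℝ))) := by
          gcongr
      _ = mu ^ h * ((#s / (h + 1) : ℕ) : ℝ) := by
          rw [hc]; field_simp
  obtain ⟨f, -, hf⟩ := exists_partial_embedding hsN T H hmu0 hmu1 hs0 hsparse univ
    (fun i => P i) (fun i _ => hP1 i) (fun i _ j _ hij => hP3 _ _ fun h => hij (Fin.ext h))
    (fun i _ => by
      rw [card_univ, Fintype.card_fin]
      exact hsize i (i.2.trans (Nat.lt_succ_self h)))
  exact contains_of_adj f fun u v => hf u (mem_univ u) v (mem_univ v)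

theorem exists_almostComplete_chain {h : ℕ} (H : Tournament h) (t : ℕ) {lam : ℝ}
    (hlam : 0 < lam) :
    ∃ c : ℝ, 0 < c ∧ ∀ (N : ℕ) (T : Tournament N), ¬ T.Contains H →
      ∀ s : Finset (Fin N), 1 ≤ c * #s → ∃ U : ℕ → Finset (Fin N),
        (∀ i < 2 ^ t, U i ⊆ s ∧ c * #s ≤ #(U i)) ∧
        ∀ i j, i < j → j < 2 ^ t → Disjoint (U i) (U j) ∧ T.AlmostComplete lam (U i) (U j) := by
  induction t with
  | zero =>
    exact ⟨1, one_pos, fun N T _ s _ => ⟨fun _ => s, fun i _ => ⟨Subset.refl _, by simp⟩,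
      fun i j hij hj => by omega⟩⟩
  | succ t ih =>
    obtain ⟨c, hc, hchain⟩ := ih
    obtain ⟨d, hd, hpair⟩ := exists_almostComplete_pair H (mul_pos hlam hc)
    refine ⟨min c 1 * d, by positivity, fun N T hT s hs => ?_⟩
    have hs0 : (0 : ℝ) ≤ #s := Nat.cast_nonneg _
    have hds : 0 ≤ d * #s := by positivity
    have h1 : min c 1 * d * #s ≤ d * #s := by
      rw [mul_assoc]; exact mul_le_of_le_one_left hds (min_le_right _ _)
    have h2 : min c 1 * d * #s ≤ c * (d * #s) := by
      rw [mul_assoc]; exact mul_le_mul_of_nonneg_right (min_le_left _ _) hds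
    obtain ⟨X, hXs, Y, hYs, hXY, hX, hY, hac⟩ := hpair N T hT s (hs.trans h1)
    have hX' := mul_le_mul_of_nonneg_left hX hc.le
    have hY' := mul_le_mul_of_nonneg_left hY hc.le
    obtain ⟨U, hU, hUU⟩ := hchain N T hT X (by linarith)
    obtain ⟨W, hW, hWW⟩ := hchain N T hT Y (by linarith)
    rw [pow_succ]
    refine ⟨fun i => if i < 2 ^ t then U i else W (i - 2 ^ t), fun i hi => ?_,
      fun i j hij hj => ?_⟩
    · by_cases hit : i < 2 ^ t
      · simp only [hit, if_true]
        exact ⟨(hU i hit).1.trans hXs, by linarith [(hU i hit).2]⟩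
      · have hit' : i - 2 ^ t < 2 ^ t := by omega
        simp only [hit, if_false]
        exact ⟨(hW _ hit').1.trans hYs, by linarith [(hW _ hit').2]⟩
    · by_cases hjt : j < 2 ^ t
      · simp only [hij.trans hjt, hjt, if_true]
        exact hUU i j hij hjt
      · have hjt_succ : j - 2 ^ t < 2 ^ t := by omega
        by_cases hit : i < 2 ^ t
        · simp only [hit, hjt, if_true, if_false]
          obtain ⟨hUX, hUc⟩ := hU i hit
          obtain ⟨hWY, hWc⟩ := hW _ hjt_succ
          refine ⟨disjoint_of_subset_left hUX (disjoint_of_subset_right hWY hXY),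
            hac.shrink (R := c⁻¹) (by positivity) hUX hWY ?_ ?_ ?_⟩
          · rwa [inv_mul_eq_div, le_div_iff₀' hc]
          · rwa [inv_mul_eq_div, le_div_iff₀' hc]
          · rw [mul_assoc, mul_inv_cancel₀ hc.ne', mul_one]
        · simp only [hit, hjt, if_false]
          exact hWW _ _ (by omega) hjt_succ

/-- Sets containing an `eta` fraction of the vertices contain transitive sets of almost the
largest size, which is at least `1 / eta`. -/
def NearCritical (T : Tournament N) (eta : ℝ) : Prop :=
  1 ≤ eta * T.trSize ∧
    ∀ A : Finset (Fin N), eta * N ≤ #A → (1 - eta) * T.trSize < (T.trSizeOn A : ℝ)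

theorem NearCritical.mono {T : Tournament N} {eta eta' : ℝ} (h : T.NearCritical eta)
    (hle : eta ≤ eta') : T.NearCritical eta' := by
  refine ⟨h.1.trans (by gcongr), fun A hA => lt_of_le_of_lt ?_ (h.2 A (le_trans ?_ hA))⟩ <;>
    gcongr

theorem trSize_le (T : Tournament N) : T.trSize ≤ N := by
  obtain ⟨t, -, -, ht⟩ := T.exists_card_eq_trSizeOn univ
  rw [trSize, ← ht]
  exact (card_le_univ t).trans_eq (Fintype.card_fin N)

/-- A chain of `m` disjoint sets, pairwise almost complete, those with index in `W` being
transitive of size linear in `T.trSize`, the others of size linear in `N`. -/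
def IsChain (T : Tournament N) (lam c : ℝ) (m : ℕ) (W : ℕ → Prop)
    (U : ℕ → Finset (Fin N)) : Prop :=
  (∀ i < m, W i → T.IsTransOn (U i) ∧ c * T.trSize ≤ #(U i)) ∧
  (∀ i < m, ¬ W i → c * N ≤ #(U i)) ∧
  ∀ i j, i < j → j < m → Disjoint (U i) (U j) ∧ T.AlmostComplete lam (U i) (U j)

theorem IsChain.shrink {T : Tournament N} {lam c R lam' c' : ℝ} {m : ℕ} {W W' : ℕ → Prop}
    {U U' : ℕ → Finset (Fin N)} (h : T.IsChain lam c m W U) (hlam : 0 ≤ lam) (hR : 0 < R)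
    (hW : ∀ i < m, W i ↔ W' i) (hsub : ∀ i < m, U' i ⊆ U i)
    (hcard : ∀ i < m, (#(U i) : ℝ) ≤ R * #(U' i)) (hlamR : lam * R ≤ lam')
    (hcR : c' * R ≤ c) : T.IsChain lam' c' m W' U' := by
  have key : ∀ i < m, ∀ x : ℕ, c * x ≤ #(U i) → c' * x ≤ #(U' i) := by
    intro i hi x hx
    have h1 : c' * R * x ≤ c * x := mul_le_mul_of_nonneg_right hcR (Nat.cast_nonneg x)
    have h2 : R * (c' * x) ≤ R * #(U' i) := by linarith [hcard i hi]
    exact le_of_mul_le_mul_left h2 hR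
  refine ⟨fun i hi hi' => ?_, fun i hi hi' => ?_, fun i j hij hj => ⟨?_, ?_⟩⟩
  · have h1 := h.1 i hi ((hW i hi).2 hi')
    exact ⟨h1.1.mono (hsub i hi), key i hi _ h1.2⟩
  · exact key i hi _ (h.2.1 i hi fun h' => hi' ((hW i hi).1 h'))
  · exact disjoint_of_subset_left (hsub i (hij.trans hj))
      (disjoint_of_subset_right (hsub j hj) (h.2.2 i j hij hj).1)
  · exact (h.2.2 i j hij hj).2.shrink hlam (hsub i (hij.trans hj)) (hsub j hj)
      (hcard i (hij.trans hj)) (hcard j hj) hlamR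

/-- One set of a chain may be replaced by an arbitrary subset. -/
theorem IsChain.exists_replace {T : Tournament N} {lam c : ℝ} {m k : ℕ} {W W' : ℕ → Prop}
    {U : ℕ → Finset (Fin N)} (h : T.IsChain lam c m W U) (hlam : 0 < lam)
    (hk : k < m) (hW : ∀ i < m, i ≠ k → (W i ↔ W' i)) (hW' : W' k) {S : Finset (Fin N)}
    (hS : S ⊆ U k) (hST : T.IsTransOn S) (hSc : c / 2 * T.trSize ≤ #S) :
    ∃ U' : ℕ → Finset (Fin N), T.IsChain (2 * lam) (c / 2) m W' U' := by
  set U' : ℕ → Finset (Fin N) := fun j =>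
    if j = k then S
    else if j < k then {v ∈ U j | (#{s ∈ S | T.adj s v} : ℝ) ≤ 2 * lam * #S}
    else {v ∈ U j | (#{s ∈ S | T.adj v s} : ℝ) ≤ 2 * lam * #S} with hU'
  have hUk : U' k = S := by simp [hU']
  have hlt : ∀ j < k, U' j = {v ∈ U j | (#{s ∈ S | T.adj s v} : ℝ) ≤ 2 * lam * #S} := by
    intro j hj; simp [hU', hj, hj.ne]
  have hgt : ∀ j, k < j → U' j = {v ∈ U j | (#{s ∈ S | T.adj v s} : ℝ) ≤ 2 * lam * #S} := by
    intro j hj; simp [hU', hj.not_gt, hj.ne']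
  have hsub : ∀ j, U' j ⊆ U j := by
    intro j
    rcases lt_trichotomy j k with hj | rfl | hj
    · rw [hlt j hj]; exact filter_subset _ _
    · rwa [hUk]
    · rw [hgt j hj]; exact filter_subset _ _
  have hcard : ∀ j < m, j ≠ k → (#(U j) : ℝ) ≤ 2 * #(U' j) := by
    intro j hj hjk
    rcases lt_or_gt_of_ne hjk with hjk | hjk
    · rw [hlt j hjk]
      exact card_le_two_mul_card_filter (fun v s => T.adj s v) _ _ hlam
        fun s hs => (h.2.2 j k hjk hk).2.2 s (hS hs)
    · rw [hgt j hjk]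
      exact card_le_two_mul_card_filter (fun v s => T.adj v s) _ _ hlam
        fun s hs => (h.2.2 k j hjk hj).2.1 s (hS hs)
  have hdense : ∀ j < m, j ≠ k → ∀ P : Fin N → Prop, (#{x ∈ U j | P x} : ℝ) ≤ lam * #(U j) →
      (#{x ∈ U' j | P x} : ℝ) ≤ 2 * lam * #(U' j) := by
    intro j hj hjk P hP
    have h1 : (#{x ∈ U' j | P x} : ℝ) ≤ #{x ∈ U j | P x} :=
      Nat.cast_le.2 (card_le_card (filter_subset_filter _ (hsub j)))
    have h2 := mul_le_mul_of_nonneg_left (hcard j hj hjk) hlam.le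
    linarith
  refine ⟨U', fun i hi hi' => ?_, fun i hi hi' => ?_, fun i j hij hj => ⟨?_, ?_⟩⟩
  · by_cases hik : i = k
    · subst hik
      rw [hUk]
      exact ⟨hST, hSc⟩
    · have h1 := h.1 i hi ((hW i hi hik).2 hi')
      exact ⟨h1.1.mono (hsub i), by linarith [hcard i hi hik]⟩
  · have hik : i ≠ k := by rintro rfl; exact hi' hW'
    have h1 := h.2.1 i hi fun h' => hi' ((hW i hi hik).1 h')
    linarith [hcard i hi hik]
  · exact disjoint_of_subset_left (hsub i)
      (disjoint_of_subset_right (hsub j) (h.2.2 i j hij hj).1)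
  · have hi := hij.trans hj
    obtain ⟨h1, h2⟩ := (h.2.2 i j hij hj).2
    by_cases hik : i = k
    · subst hik
      rw [hUk]
      refine ⟨fun s hs => hdense j hj hij.ne' _ (h1 s (hS hs)), fun y hy => ?_⟩
      rw [hgt j hij] at hy
      exact (mem_filter.1 hy).2
    · by_cases hjk : j = k
      · subst hjk
        rw [hUk]
        refine ⟨fun x hx => ?_, fun s hs => hdense i hi hik _ (h2 s (hS hs))⟩
        rw [hlt i hij] at hx
        exact (mem_filter.1 hx).2
      · exact ⟨fun x hx => hdense j hj hjk _ (h1 x (hsub i hx)),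
          fun y hy => hdense i hi hik _ (h2 y (hsub j hy))⟩

theorem exists_isChain_aux {h : ℕ} (H : Tournament h) (m k : ℕ) {lam : ℝ} (hlam : 0 < lam) :
    ∃ c : ℝ, 0 < c ∧ c ≤ 1 / 2 ∧ ∀ (N : ℕ) (T : Tournament N), ¬ T.Contains H →
      T.NearCritical c → ∃ U, T.IsChain lam c m (fun i => Even i ∧ i < k) U := by
  induction k generalizing lam with
  | zero =>
    obtain ⟨c, hc, hchain⟩ := exists_almostComplete_chain H m hlam
    refine ⟨min c (1 / 2), by positivity, min_le_right _ _, fun N T hT hcrit => ?_⟩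
    have h1 : min c (1 / 2) * T.trSize ≤ c * N := by
      have := T.trSize_le
      gcongr
      exact min_le_left _ _
    obtain ⟨U, hU, hUU⟩ := hchain N T hT univ (by simpa using hcrit.1.trans h1)
    refine ⟨U, fun i _ hi => absurd hi.2 (Nat.not_lt_zero i), fun i hi _ => ?_,
      fun i j hij hj => hUU i j hij (hj.trans Nat.lt_two_pow_self)⟩
    refine le_trans ?_ (hU i (hi.trans Nat.lt_two_pow_self)).2
    simp only [card_univ, Fintype.card_fin]
    gcongr
    exact min_le_left _ _
  | succ k ih =>
    obtain ⟨c, hc, hc2, hstep⟩ := ih (half_pos hlam)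
    refine ⟨c / 2, half_pos hc, by linarith, fun N T hT hcrit => ?_⟩
    have hcrit' : T.NearCritical c := hcrit.mono (by linarith)
    obtain ⟨U, hU⟩ := hstep N T hT hcrit'
    by_cases hk : k < m ∧ Even k
    · obtain ⟨S, hS, hST, hSc⟩ := T.exists_card_eq_trSizeOn (U k)
      have h1 := hcrit'.2 (U k) (hU.2.1 k hk.1 fun h => lt_irrefl _ h.2)
      have h2 : (0 : ℝ) ≤ T.trSize := Nat.cast_nonneg _
      obtain ⟨U', hU'⟩ := hU.exists_replace (W' := fun i => Even i ∧ i < k + 1) (half_pos hlam)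
        hk.1 (fun i _ hik => by simp only [Nat.lt_succ_iff_lt_or_eq, hik, or_false])
        ⟨hk.2, Nat.lt_succ_self k⟩ hS hST (by rw [hSc]; nlinarith)
      exact ⟨U', by rwa [mul_div_cancel₀ _ two_ne_zero] at hU'⟩
    · refine ⟨U, hU.shrink (R := 1) (by positivity) one_pos (fun i hi => ?_)
        (fun i _ => Subset.refl _) (fun i _ => by simp) (by linarith) (by linarith)⟩
      have : ∀ _ : Even i, i ≠ k := by rintro h rfl; exact hk ⟨hi, h⟩
      constructor <;> rintro ⟨h1, h2⟩ <;> have := this h1 <;> exact ⟨h1, by omega⟩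

theorem exists_isChain {h : ℕ} (H : Tournament h) (m : ℕ) {lam : ℝ} (hlam : 0 < lam) :
    ∃ c : ℝ, 0 < c ∧ c ≤ 1 / 2 ∧ ∀ (N : ℕ) (T : Tournament N), ¬ T.Contains H →
      T.NearCritical c → ∃ U, T.IsChain lam c m Even U := by
  obtain ⟨c, hc, hc2, hchain⟩ := exists_isChain_aux H m m hlam
  refine ⟨c, hc, hc2, fun N T hT hcrit => ?_⟩
  obtain ⟨U, hU⟩ := hchain N T hT hcrit
  exact ⟨U, hU.shrink (R := 1) hlam.le one_pos (fun i hi => by simp [hi])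
    (fun i _ => Subset.refl _) (fun i _ => by simp) (by simp) (by simp)⟩

/-- The subtournament of `T` on the image of `f`. -/
def comap {k : ℕ} (T : Tournament N) (f : Fin k ↪ Fin N) : Tournament k where
  adj u v := T.adj (f u) (f v)
  asymm _ _ h := T.asymm _ _ h
  total _ _ h := T.total _ _ (f.injective.ne h)

theorem Contains.of_comap {k n : ℕ} {T : Tournament N} {f : Fin k ↪ Fin N} {H : Tournament n}
    (h : (T.comap f).Contains H) : T.Contains H := by
  obtain ⟨g, hg⟩ := h
  exact ⟨g.trans f, fun u v => hg u v⟩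

theorem trSize_comap_le {k : ℕ} (T : Tournament N) (f : Fin k ↪ Fin N) {s : Finset (Fin N)}
    (hf : ∀ i, f i ∈ s) : (T.comap f).trSize ≤ T.trSizeOn s := by
  obtain ⟨t, -, ht, htc⟩ := (T.comap f).exists_card_eq_trSizeOn univ
  rw [trSize, ← htc, ← card_map f]
  refine card_le_trSizeOn (fun x hx => ?_) fun u hu v hv w hw => ?_
  · obtain ⟨i, -, rfl⟩ := mem_map.1 hx
    exact hf i
  · obtain ⟨a, ha, rfl⟩ := mem_map.1 hu
    obtain ⟨b, hb, rfl⟩ := mem_map.1 hv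
    obtain ⟨c, hc, rfl⟩ := mem_map.1 hw
    exact ht a ha b hb c hc

theorem ehPair_of_forall_not_epsCritical {n₁ n₂ : ℕ} {H₁ : Tournament n₁} {H₂ : Tournament n₂}
    {ε : ℝ} (hε : 0 < ε) (h : ∀ (N : ℕ) (T : Tournament N), ¬ T.Contains H₁ →
      ¬ T.Contains H₂ → ¬ T.EpsCritical ε) : EHPair H₁ H₂ := by
  refine ⟨ε, hε, fun N => ?_⟩
  induction N using Nat.strong_induction_on with
  | _ N ih =>
    intro T h1 h2
    by_contra! hlt
    refine h N T h1 h2 ⟨hlt, fun s hs => ?_⟩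
    set f : Fin #s ↪ Fin N := (s.orderEmbOfFin rfl).toEmbedding
    have hcard : #s < N := by
      have := card_lt_card (ssubset_univ_iff.2 hs)
      rwa [card_univ, Fintype.card_fin] at this
    refine (ih #s hcard (T.comap f) (fun h => h1 h.of_comap) fun h => h2 h.of_comap).trans ?_
    exact Nat.cast_le.2 (T.trSize_comap_le f fun i => s.orderEmbOfFin_mem rfl i)

theorem exists_forall_nearCritical {eta : ℝ} (heta : 0 < eta) :
    ∃ ε : ℝ, 0 < ε ∧ ∀ (N : ℕ) (T : Tournament N), T.EpsCritical ε → T.NearCritical eta := by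
  obtain ⟨k, hk⟩ := exists_nat_ge (1 / eta)
  have hev : ∀ a : ℝ, 0 < a → Filter.Tendsto (fun x : ℝ => a ^ x) (nhdsWithin 0 (Set.Ioi 0))
      (nhds 1) := by
    intro a ha
    have h1 := (Real.continuous_const_rpow ha.ne').tendsto 0
    rw [Real.rpow_zero] at h1
    exact h1.mono_left nhdsWithin_le_nhds
  have h1 := (hev eta heta).eventually (lt_mem_nhds (show 1 - eta < 1 by linarith))
  have h2 := (hev (2 ^ k) (by positivity)).eventually (gt_mem_nhds (show (1 : ℝ) < 2 by norm_num))
  obtain ⟨ε, ⟨hε1, hε2⟩, hε⟩ := ((h1.and h2).and self_mem_nhdsWithin).exists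
  replace hε : 0 < ε := hε
  refine ⟨ε, hε, fun N T hT => ?_⟩
  have htr : k < T.trSize := by
    by_contra! hle
    have hN : N < 2 ^ k := by
      by_contra! h
      exact hle.not_gt (T.lt_trSizeOn_of_two_pow_le k univ (by simpa using h))
    have hlt := hT.1
    rcases Nat.lt_or_ge N 2 with h2 | h2
    · interval_cases N
      · rw [Nat.cast_zero, Real.zero_rpow hε.ne'] at hlt
        exact absurd hlt (Nat.cast_nonneg _).not_gt
      · rw [Nat.cast_one, Real.one_rpow] at hlt
        have h3 : 0 < T.trSize := T.lt_trSizeOn_of_two_pow_le 0 univ (by simp)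
        exact absurd (Nat.cast_lt_one.1 hlt) h3.ne'
    · have h3 : 1 < T.trSize := T.lt_trSizeOn_of_two_pow_le 1 univ (by simpa using h2)
      have h4 : (N : ℝ) ^ ε ≤ (2 ^ k : ℝ) ^ ε :=
        Real.rpow_le_rpow (Nat.cast_nonneg _) (by exact_mod_cast hN.le) hε.le
      have h5 : (2 : ℝ) ≤ T.trSize := by exact_mod_cast h3
      linarith
  have htr' : (k : ℝ) ≤ T.trSize := by exact_mod_cast htr.le
  have htr0 : (0 : ℝ) < T.trSize := by exact_mod_cast (Nat.zero_le k).trans_lt htr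
  refine ⟨?_, fun A hA => ?_⟩
  · rw [div_le_iff₀' heta] at hk
    exact hk.trans (mul_le_mul_of_nonneg_left htr' heta.le)
  · by_cases hAu : A = univ
    · subst hAu
      change _ < (T.trSize : ℝ)
      nlinarith
    · have hpow : 0 < eta ^ ε := Real.rpow_pos_of_pos heta ε
      calc (1 - eta) * T.trSize ≤ eta ^ ε * T.trSize :=
            mul_le_mul_of_nonneg_right hε1.le htr0.le
        _ < eta ^ ε * (N : ℝ) ^ ε := mul_lt_mul_of_pos_left hT.1 hpow
        _ = (eta * N) ^ ε := (Real.mul_rpow heta.le (Nat.cast_nonneg _)).symm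
        _ ≤ (#A : ℝ) ^ ε := Real.rpow_le_rpow (by positivity) hA hε.le
        _ ≤ T.trSizeOn A := hT.2 A hAu

theorem exists_adj_of_trSize_lt {T : Tournament N} {X Y : Finset (Fin N)} (hXY : Disjoint X Y)
    (h : (T.trSize : ℝ) < T.trSizeOn X + T.trSizeOn Y) : ∃ x ∈ X, ∃ y ∈ Y, T.adj y x := by
  by_contra! hno
  have h1 := trSizeOn_add_le (T := T) (s := X) (t := Y) fun x hx y hy =>
    (T.total x y (disjoint_iff_ne.1 hXY x hx y hy)).resolve_right (hno x hx y hy)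
  have h2 : (T.trSizeOn X + T.trSizeOn Y : ℝ) ≤ T.trSize := by exact_mod_cast h1
  linarith

/-- Most vertices of a large set have, for each transitive set of a small family, an arc in a
prescribed direction to a vertex of that set. -/
theorem NearCritical.le_card_filter {T : Tournament N} {eta : ℝ} (hT : T.NearCritical eta)
    {ι : Type*} (L : Finset ι) (V : ι → Finset (Fin N)) (A : Finset (Fin N))
    (hdisj : ∀ l ∈ L, Disjoint A (V l)) (hV : ∀ l ∈ L, T.IsTransOn (V l))
    (hVc : ∀ l ∈ L, eta * T.trSize ≤ #(V l)) (hA : (#L + 1) * (eta * N) ≤ #A)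
    (r : Fin N → Fin N → Prop) (hr : r = T.adj ∨ r = fun x y => T.adj y x) :
    eta * N ≤ #{a ∈ A | ∀ l ∈ L, ∃ s ∈ V l, r a s} := by
  set bad : ι → Finset (Fin N) := fun l => {a ∈ A | ∀ s ∈ V l, ¬ r a s} with hbad
  have hbadc : ∀ l ∈ L, (#(bad l) : ℝ) ≤ eta * N := by
    intro l hl
    by_contra! hlt
    have h1 := hT.2 _ hlt.le
    have h2 : (#(V l) : ℝ) ≤ T.trSizeOn (V l) :=
      Nat.cast_le.2 (card_le_trSizeOn (Subset.refl _) (hV l hl))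
    have h3 := hVc l hl
    have h4 : Disjoint (bad l) (V l) := disjoint_of_subset_left (filter_subset _ _) (hdisj l hl)
    rcases hr with rfl | rfl
    · obtain ⟨s, hs, a, ha, has⟩ := exists_adj_of_trSize_lt (T := T) h4.symm (by linarith)
      exact (mem_filter.1 ha).2 s hs has
    · obtain ⟨a, ha, s, hs, has⟩ := exists_adj_of_trSize_lt (T := T) h4 (by linarith)
      exact (mem_filter.1 ha).2 s hs has
  have hcover : A ⊆ {a ∈ A | ∀ l ∈ L, ∃ s ∈ V l, r a s} ∪ L.biUnion bad := by
    intro a ha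
    by_cases h : ∀ l ∈ L, ∃ s ∈ V l, r a s
    · exact mem_union_left _ (mem_filter.2 ⟨ha, h⟩)
    · push Not at h
      obtain ⟨l, hl, hs⟩ := h
      exact mem_union_right _ (mem_biUnion.2 ⟨l, hl, mem_filter.2 ⟨ha, hs⟩⟩)
  have h1 : (#A : ℝ) ≤ #{a ∈ A | ∀ l ∈ L, ∃ s ∈ V l, r a s} + ∑ l ∈ L, (#(bad l) : ℝ) := by
    exact_mod_cast (card_le_card hcover).trans
      ((card_union_le _ _).trans (Nat.add_le_add_left card_biUnion_le _))
  have h2 : ∑ l ∈ L, (#(bad l) : ℝ) ≤ #L * (eta * N) := by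
    simpa using sum_le_sum hbadc
  linarith

theorem pos_lt_or_gt {n : ℕ} (θ : Equiv.Perm (Fin n)) {u v : Fin n} (h : u ≠ v) :
    pos θ u < pos θ v ∨ pos θ v < pos θ u :=
  lt_or_gt_of_ne (θ.symm.injective.ne h)

/-- Embedding of `H` in pairwise almost complete sets, one component of the backward arcs at
a time. -/
theorem contains_of_components {n : ℕ} {T : Tournament N} {H : Tournament n}
    (θ : Equiv.Perm (Fin n)) (V : Fin n → Finset (Fin N)) {κ : Type*} [Fintype κ]
    (C : κ → Finset (Fin n)) (hcover : ∀ v, ∃ k, v ∈ C k)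
    (hdisj : ∀ k l, k ≠ l → Disjoint (C k) (C l))
    (hback : ∀ u v, H.Backward θ u v → ∃ k, u ∈ C k ∧ v ∈ C k)
    (hV : ∀ u v, pos θ u < pos θ v →
      Disjoint (V u) (V v) ∧ T.AlmostComplete (1 / (2 * n)) (V u) (V v))
    (hfind : ∀ k, ∀ V' : Fin n → Finset (Fin N), (∀ v, V' v ⊆ V v) →
      (∀ v, (#(V v) : ℝ) ≤ 2 * #(V' v)) → ∃ f : Fin n → Fin N, (∀ v ∈ C k, f v ∈ V' v) ∧
        ∀ u ∈ C k, ∀ v ∈ C k, H.adj u v → T.adj (f u) (f v)) : T.Contains H := by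
  rcases Nat.eq_zero_or_pos n with rfl | hn
  · exact contains_of_adj (fun u => u.elim0) fun u => u.elim0
  have hn0 : (0 : ℝ) < n := Nat.cast_pos.2 hn
  have hmain : ∀ K : Finset κ, ∃ f : Fin n → Fin N, (∀ v ∈ K.biUnion C, f v ∈ V v) ∧
      ∀ u ∈ K.biUnion C, ∀ v ∈ K.biUnion C, H.adj u v → T.adj (f u) (f v) := by
    intro K
    induction K using Finset.induction_on with
    | empty =>
      obtain ⟨k, -⟩ := hcover ⟨0, hn⟩
      obtain ⟨f, -, -⟩ := hfind k V (fun v => Subset.refl _) fun v => by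
        linarith [(Nat.cast_nonneg #(V v) : (0 : ℝ) ≤ _)]
      exact ⟨f, by simp, by simp⟩
    | insert k K hk ih =>
      obtain ⟨f, hf, hfadj⟩ := ih
      set P := K.biUnion C with hP
      have hPk : ∀ u ∈ P, u ∉ C k := by
        intro u hu huk
        obtain ⟨l, hl, hul⟩ := mem_biUnion.1 hu
        have hne : l ≠ k := by rintro rfl; exact hk hl
        exact disjoint_left.1 (hdisj l k hne) hul huk
      have hforward : ∀ u v, (u ∈ P ∧ v ∈ C k) ∨ (u ∈ C k ∧ v ∈ P) → H.adj u v →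
          pos θ u < pos θ v := by
        intro u v huv hadj
        by_contra hnot
        have hne : u ≠ v := by rintro rfl; exact H.irrefl _ hadj
        obtain ⟨l, hul, hvl⟩ := hback u v ⟨hadj, (pos_lt_or_gt θ hne).resolve_left hnot⟩
        have hsame : ∀ w, w ∈ C k → w ∈ C l → l = k := fun w h1 h2 => by
          by_contra hne
          exact disjoint_left.1 (hdisj l k hne) h2 h1
        rcases huv with ⟨hu, hv⟩ | ⟨hu, hv⟩
        · exact hPk u hu (hsame v hv hvl ▸ hul)
        · exact hPk v hv (hsame u hu hul ▸ hvl)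
      set r : Fin n → Fin n → Fin N → Prop := fun v u x =>
        (pos θ u < pos θ v → T.adj (f u) x) ∧ (pos θ v < pos θ u → T.adj x (f u)) with hr
      set V' : Fin n → Finset (Fin N) := fun v =>
        if v ∈ C k then {x ∈ V v | ∀ u ∈ P, r v u x} else V v with hV'
      have hVk : ∀ v ∈ C k, V' v = {x ∈ V v | ∀ u ∈ P, r v u x} := fun v hv => by
        simp [hV', hv]
      have hwrong : ∀ v ∈ C k, ∀ u ∈ P,
          (#{x ∈ V v | ¬ r v u x} : ℝ) ≤ 1 / (2 * n) * #(V v) := by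
        intro v hv u hu
        have hne : u ≠ v := by rintro rfl; exact hPk _ hu hv
        rcases pos_lt_or_gt θ hne with hlt | hlt
        · obtain ⟨h1, h2⟩ := hV u v hlt
          refine le_trans (Nat.cast_le.2 (card_le_card fun x hx => ?_)) (h2.1 (f u) (hf u hu))
          rw [mem_filter] at hx ⊢
          refine ⟨hx.1, (T.total x (f u) ?_).resolve_right fun h => hx.2 ⟨fun _ => h, fun h' =>
            absurd h' hlt.not_gt⟩⟩
          rintro rfl
          exact disjoint_left.1 h1 (hf u hu) hx.1
        · obtain ⟨h1, h2⟩ := hV v u hlt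
          refine le_trans (Nat.cast_le.2 (card_le_card fun x hx => ?_)) (h2.2 (f u) (hf u hu))
          rw [mem_filter] at hx ⊢
          refine ⟨hx.1, (T.total (f u) x ?_).resolve_right fun h => hx.2 ⟨fun h' =>
            absurd h' hlt.not_gt, fun _ => h⟩⟩
          rintro rfl
          exact disjoint_left.1 h1 hx.1 (hf u hu)
      obtain ⟨g, hg, hgadj⟩ := hfind k V' (fun v => by
          simp only [hV']; split_ifs; exacts [filter_subset _ _, Subset.refl _]) (fun v => by
        by_cases hv : v ∈ C k
        · rw [hVk v hv]
          have hcov : V v ⊆ {x ∈ V v | ∀ u ∈ P, r v u x} ∪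
              P.biUnion fun u => {x ∈ V v | ¬ r v u x} := by
            intro x hx
            by_cases h : ∀ u ∈ P, r v u x
            · exact mem_union_left _ (mem_filter.2 ⟨hx, h⟩)
            · obtain ⟨u, hu, hux⟩ := not_forall₂.1 h
              exact mem_union_right _ (mem_biUnion.2 ⟨u, hu, mem_filter.2 ⟨hx, hux⟩⟩)
          have h1 : (#(V v) : ℝ) ≤ #{x ∈ V v | ∀ u ∈ P, r v u x} +
              ∑ u ∈ P, (#{x ∈ V v | ¬ r v u x} : ℝ) := by
            exact_mod_cast (card_le_card hcov).trans
              ((card_union_le _ _).trans (Nat.add_le_add_left card_biUnion_le _))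
          have h2 : ∑ u ∈ P, (#{x ∈ V v | ¬ r v u x} : ℝ) ≤ #P * (1 / (2 * n) * #(V v)) := by
            simpa using sum_le_sum (hwrong v hv)
          have h3 : (#P : ℝ) ≤ n := by
            exact_mod_cast (card_le_univ P).trans_eq (Fintype.card_fin n)
          have h4 : (#P : ℝ) * (1 / (2 * n) * #(V v)) ≤ n * (1 / (2 * n) * #(V v)) := by gcongr
          have h5 : (n : ℝ) * (1 / (2 * n) * #(V v)) = #(V v) / 2 := by field_simp
          linarith
        · simp only [hV', hv, if_false]
          linarith [(Nat.cast_nonneg #(V v) : (0 : ℝ) ≤ _)])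
      have hgr : ∀ v ∈ C k, g v ∈ V v ∧ ∀ u ∈ P, r v u (g v) := fun v hv => by
        have := hg v hv
        rwa [hVk v hv, mem_filter] at this
      have hF : ∀ v ∈ P, (fun v => if v ∈ C k then g v else f v) v = f v := fun v hv => by
        simp [hPk v hv]
      have hG : ∀ v ∈ C k, (fun v => if v ∈ C k then g v else f v) v = g v := fun v hv => by
        simp [hv]
      rw [biUnion_insert]
      refine ⟨fun v => if v ∈ C k then g v else f v, fun v hv => ?_, fun u hu v hv hadj => ?_⟩
      · rcases mem_union.1 hv with hv | hv
        · rw [hG v hv]; exact (hgr v hv).1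
        · rw [hF v hv]; exact hf v hv
      · rcases mem_union.1 hu with hu | hu <;> rcases mem_union.1 hv with hv | hv
        · rw [hG v hv, hG u hu]; exact hgadj u hu v hv hadj
        · rw [hF v hv, hG u hu]
          exact ((hgr u hu).2 v hv).2 (hforward u v (Or.inr ⟨hu, hv⟩) hadj)
        · rw [hG v hv, hF u hu]
          exact ((hgr v hv).2 u hu).1 (hforward u v (Or.inl ⟨hu, hv⟩) hadj)
        · rw [hF v hv, hF u hu]; exact hfadj u hu v hv hadj
  obtain ⟨f, -, hf⟩ := hmain univ
  have hmem : ∀ v, v ∈ (univ : Finset κ).biUnion C := fun v => by simpa using hcover v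
  exact contains_of_adj f fun u v => hf u (hmem u) v (hmem v)

/-- The number of vertices of `D` that precede `v`. -/
def rankIn {n : ℕ} (θ : Equiv.Perm (Fin n)) (D : Finset (Fin n)) (v : Fin n) : ℕ :=
  #{x ∈ D | pos θ x < pos θ v}

/-- The index of the set of a chain in which `v` is embedded: an odd index for the vertices of
`D`, an even one for the others. -/
def slot {n : ℕ} (θ : Equiv.Perm (Fin n)) (D : Finset (Fin n)) (g : ℕ → ℕ) (v : Fin n) : ℕ :=
  2 * g (rankIn θ D v) + if v ∈ D then 1 else 0

section Slot

variable {n : ℕ} {θ : Equiv.Perm (Fin n)} {D : Finset (Fin n)} {g : ℕ → ℕ}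

theorem rankIn_le (θ : Equiv.Perm (Fin n)) (D : Finset (Fin n)) (v : Fin n) :
    rankIn θ D v ≤ n :=
  (card_le_univ _).trans_eq (Fintype.card_fin n)

theorem rankIn_mono {u v : Fin n} (h : pos θ u ≤ pos θ v) : rankIn θ D u ≤ rankIn θ D v :=
  card_le_card fun x hx => by
    rw [mem_filter] at hx ⊢
    exact ⟨hx.1, hx.2.trans_le h⟩

theorem rankIn_lt {u v : Fin n} (hu : u ∈ D) (h : pos θ u < pos θ v) :
    rankIn θ D u < rankIn θ D v := by
  refine card_lt_card ⟨fun x hx => ?_, fun hsub => ?_⟩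
  · rw [mem_filter] at hx ⊢
    exact ⟨hx.1, hx.2.trans h⟩
  · exact lt_irrefl _ (mem_filter.1 (hsub (mem_filter.2 ⟨hu, h⟩))).2

theorem rankIn_eq_of_not_between {L : Finset (Fin n)} (hL : Disjoint L D)
    (hbet : ∀ x ∈ D, ¬ BetweenSet θ L x) {u v : Fin n} (hu : u ∈ L) (hv : v ∈ L) :
    rankIn θ D u = rankIn θ D v := by
  wlog huv : pos θ u ≤ pos θ v generalizing u v
  · exact (this hv hu (le_of_not_ge huv)).symm
  refine (rankIn_mono huv).antisymm (card_le_card fun x hx => ?_)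
  rw [mem_filter] at hx ⊢
  refine ⟨hx.1, ?_⟩
  by_contra hnot
  have hne : u ≠ x := fun h => disjoint_left.1 hL hu (h ▸ hx.1)
  exact hbet x hx.1 ⟨u, hu, v, hv, (pos_lt_or_gt θ hne).resolve_right hnot, hx.2⟩

theorem even_slot {v : Fin n} : Even (slot θ D g v) ↔ v ∉ D := by
  unfold slot
  split_ifs with h <;> simp [h, parity_simps]

theorem slot_lt {m : ℕ} (hg : StrictMono g) (hm : 2 * g n + 1 < m) (v : Fin n) :
    slot θ D g v < m := by
  have := hg.monotone (rankIn_le θ D v)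
  unfold slot
  split_ifs <;> omega

theorem slot_lt_or_eq (hg : StrictMono g) {u v : Fin n} (h : pos θ u < pos θ v) :
    slot θ D g u < slot θ D g v ∨ u ∉ D ∧ v ∉ D ∧ slot θ D g u = slot θ D g v := by
  have h1 := hg.monotone (rankIn_mono (D := D) h.le)
  unfold slot
  by_cases hu : u ∈ D
  · have := hg (rankIn_lt hu h)
    split_ifs
    all_goals omega
  · by_cases hv : v ∈ D <;> simp only [hu, hv, if_true, if_false] <;> grind

theorem slot_eq_of_not_between {L : Finset (Fin n)} (hL : Disjoint L D)
    (hbet : ∀ x ∈ D, ¬ BetweenSet θ L x) {u v : Fin n} (hu : u ∈ L) (hv : v ∈ L) :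
    slot θ D g u = slot θ D g v := by
  simp [slot, rankIn_eq_of_not_between hL hbet hu hv, disjoint_left.1 hL hu,
    disjoint_left.1 hL hv]

end Slot

/-- Embedding of `H` in a chain: the vertices of `D` go to the sets of odd index, the others to
blocks of the transitive sets of even index. -/
theorem IsChain.contains {T : Tournament N} {lam c : ℝ} {m h n : ℕ} {W : ℕ → Finset (Fin N)}
    (hW : T.IsChain lam c m Even W) (hlam : 0 ≤ lam) (hh : 0 < h) (hnh : n ≤ h)
    (hlamh : lam * (2 * h) ≤ 1 / (2 * h)) (hc : h ≤ c * T.trSize) {H : Tournament n}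
    {θ : Equiv.Perm (Fin n)} {D : Finset (Fin n)} {g : ℕ → ℕ} (hg : StrictMono g)
    (hm : 2 * g n + 1 < m) {κ : Type*} [Fintype κ]
    (C : κ → Finset (Fin n)) (hcover : ∀ v, ∃ k, v ∈ C k)
    (hdisj : ∀ k l, k ≠ l → Disjoint (C k) (C l))
    (hback : ∀ u v, H.Backward θ u v → ∃ k, u ∈ C k ∧ v ∈ C k)
    (hfind : ∀ k, ∀ V' : Fin n → Finset (Fin N), (∀ v, V' v ⊆ W (slot θ D g v)) →
      (∀ v, (#(W (slot θ D g v)) : ℝ) ≤ 4 * h * #(V' v)) →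
      (∀ u v, u ∉ D → v ∉ D → slot θ D g u = slot θ D g v → pos θ u < pos θ v →
        ∀ x ∈ V' u, ∀ y ∈ V' v, T.adj x y) →
      ∃ f : Fin n → Fin N, (∀ v ∈ C k, f v ∈ V' v) ∧
        ∀ u ∈ C k, ∀ v ∈ C k, H.adj u v → T.adj (f u) (f v)) : T.Contains H := by
  have hblocks : ∀ i, ∃ P : ℕ → Finset (Fin N), i < m → Even i → (∀ j, P j ⊆ W i) ∧
      (∀ j < h, #(P j) = #(W i) / h) ∧
      ∀ j k, j < k → ∀ x ∈ P j, ∀ y ∈ P k, T.adj x y := by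
    intro i
    by_cases hi : i < m ∧ Even i
    · obtain ⟨P, hP⟩ := (hW.1 i hi.1 hi.2).1.exists_blocks h
      exact ⟨P, fun _ _ => hP⟩
    · exact ⟨fun _ => ∅, fun h1 h2 => absurd ⟨h1, h2⟩ hi⟩
  choose P hP using hblocks
  have hsm : ∀ v, slot θ D g v < m := slot_lt hg hm
  have hh1 : (1 : ℝ) ≤ h := by exact_mod_cast hh
  set V : Fin n → Finset (Fin N) := fun v =>
    if v ∈ D then W (slot θ D g v) else P (slot θ D g v) (pos θ v) with hVdef
  have hVD : ∀ v ∉ D, V v = P (slot θ D g v) (pos θ v) := fun v hv => by simp [hVdef, hv]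
  have hVW : ∀ v, V v ⊆ W (slot θ D g v) := by
    intro v
    by_cases hv : v ∈ D
    · simp [hVdef, hv]
    · rw [hVD v hv]
      exact (hP _ (hsm v) (even_slot.2 hv)).1 _
  have hVc : ∀ v, (#(W (slot θ D g v)) : ℝ) ≤ 2 * h * #(V v) := by
    intro v
    by_cases hv : v ∈ D
    · simp only [hVdef, hv, if_true]
      exact le_mul_of_one_le_left (Nat.cast_nonneg _) (by linarith)
    · rw [hVD v hv, (hP _ (hsm v) (even_slot.2 hv)).2.1 _ ((pos θ v).2.trans_le hnh)]
      exact le_two_mul_div hh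
        (Nat.cast_le.1 (hc.trans (hW.1 _ (hsm v) (even_slot.2 hv)).2))
  have hcomplete : ∀ u v, u ∉ D → v ∉ D → slot θ D g u = slot θ D g v → pos θ u < pos θ v →
      ∀ x ∈ V u, ∀ y ∈ V v, T.adj x y := by
    intro u v hu hv huv hlt
    rw [hVD u hu, hVD v hv, huv]
    exact (hP _ (hsm v) (even_slot.2 hv)).2.2 _ _ hlt
  refine contains_of_components θ V C hcover hdisj hback (fun u v huv => ?_)
    fun k V' hV' hV'c => hfind k V' (fun v => (hV' v).trans (hVW v)) (fun v => ?_)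
      fun u v hu hv heq hlt x hx y hy => hcomplete u v hu hv heq hlt x (hV' u hx) y (hV' v hy)
  · have hn0 : (0 : ℝ) < n := by exact_mod_cast u.pos
    have hlamn : lam * (2 * h) ≤ 1 / (2 * n) := hlamh.trans (by gcongr)
    rcases slot_lt_or_eq (D := D) hg huv with hlt | ⟨hu, hv, heq⟩
    · have hdis := hW.2.2 _ _ hlt (hsm v)
      exact ⟨disjoint_of_subset_left (hVW u) (disjoint_of_subset_right (hVW v) hdis.1),
        hdis.2.shrink hlam (hVW u) (hVW v) (hVc u) (hVc v) hlamn⟩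
    · have hcomp := hcomplete u v hu hv heq huv
      refine ⟨disjoint_left.2 fun x hx hy => T.irrefl x (hcomp x hx x hy), fun x hx => ?_,
        fun y hy => ?_⟩
      · rw [filter_false_of_mem fun y hy => T.asymm _ _ (hcomp x hx y hy)]
        rw [card_empty, Nat.cast_zero]
        exact mul_nonneg (by positivity) (Nat.cast_nonneg _)
      · rw [filter_false_of_mem fun x hx => T.asymm _ _ (hcomp x hx y hy)]
        rw [card_empty, Nat.cast_zero]
        exact mul_nonneg (by positivity) (Nat.cast_nonneg _)
  · have h1 := mul_le_mul_of_nonneg_left (hV'c v) (by positivity : (0 : ℝ) ≤ 2 * h)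
    linarith [hVc v]

/-- The sets `V v`, one for each vertex `v` of an ordered tournament, from which copies of stars
with centers in `D` can be found. -/
def IsPlacement {n : ℕ} (T : Tournament N) (eta : ℝ) (θ : Equiv.Perm (Fin n))
    (D : Finset (Fin n)) (V : Fin n → Finset (Fin N)) : Prop :=
  (∀ v ∈ D, (n + 1) * (eta * N) ≤ #(V v)) ∧
  (∀ v ∉ D, T.IsTransOn (V v) ∧ eta * T.trSize ≤ #(V v)) ∧
  (∀ u ∈ D, ∀ v, u ≠ v → Disjoint (V u) (V v)) ∧
  ∀ u v, u ∉ D → v ∉ D → rankIn θ D u = rankIn θ D v → pos θ u < pos θ v →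
    ∀ x ∈ V u, ∀ y ∈ V v, T.adj x y

theorem ne_of_adj {T : Tournament N} {u v : Fin N} (h : T.adj u v) : u ≠ v := by
  rintro rfl
  exact T.irrefl _ h

theorem IsChain.isPlacement {T : Tournament N} {lam c eta : ℝ} {m h n : ℕ}
    {W : ℕ → Finset (Fin N)} (hW : T.IsChain lam c m Even W) (hh : 0 < h) (heta : 0 ≤ eta)
    (hceta : 4 * h * ((n + 1) * eta) ≤ c) {θ : Equiv.Perm (Fin n)} {D : Finset (Fin n)}
    {g : ℕ → ℕ} (hg : StrictMono g) (hm : 2 * g n + 1 < m) {V : Fin n → Finset (Fin N)}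
    (hVW : ∀ v, V v ⊆ W (slot θ D g v))
    (hVc : ∀ v, (#(W (slot θ D g v)) : ℝ) ≤ 4 * h * #(V v))
    (hcomp : ∀ u v, u ∉ D → v ∉ D → slot θ D g u = slot θ D g v → pos θ u < pos θ v →
      ∀ x ∈ V u, ∀ y ∈ V v, T.adj x y) : T.IsPlacement eta θ D V := by
  have hh0 : (0 : ℝ) < 4 * h := by positivity
  have hsm : ∀ v, slot θ D g v < m := slot_lt hg hm
  have hlt : ∀ u v, pos θ u < pos θ v → u ∈ D ∨ v ∈ D → Disjoint (V u) (V v) := by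
    intro u v h huv
    rcases slot_lt_or_eq (D := D) hg h with hlt | ⟨hu, hv, -⟩
    · exact disjoint_of_subset_left (hVW u)
        (disjoint_of_subset_right (hVW v) (hW.2.2 _ _ hlt (hsm v)).1)
    · exact (huv.elim hu hv).elim
  refine ⟨fun v hv => ?_, fun v hv => ?_, fun u hu v huv => ?_, fun u v hu hv huv => ?_⟩
  · have h1 := hW.2.1 _ (hsm v) fun h => even_slot.1 h hv
    have h2 := mul_le_mul_of_nonneg_right hceta (Nat.cast_nonneg N : (0 : ℝ) ≤ N)
    refine le_of_mul_le_mul_left ?_ hh0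
    linarith [hVc v]
  · obtain ⟨h0, h1⟩ := hW.1 _ (hsm v) (even_slot.2 hv)
    have h2 := mul_le_mul_of_nonneg_right hceta (Nat.cast_nonneg T.trSize : (0 : ℝ) ≤ T.trSize)
    have h3 : 0 ≤ 4 * h * (n * eta * T.trSize) := by positivity
    exact ⟨h0.mono (hVW v), le_of_mul_le_mul_left (by linarith [hVc v]) hh0⟩
  · rcases pos_lt_or_gt θ huv with h | h
    exacts [hlt u v h (Or.inl hu), (hlt v u h (Or.inr hu)).symm]
  · exact hcomp u v hu hv (by simp [slot, hu, hv, huv])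

/-- In a near critical tournament, a star with center in `D` can be found in a placement. -/
theorem IsPlacement.exists_star {n : ℕ} {T : Tournament N} {H : Tournament n} {eta : ℝ}
    {θ : Equiv.Perm (Fin n)} {D : Finset (Fin n)} {V : Fin n → Finset (Fin N)}
    (hV : T.IsPlacement eta θ D V) (hT : T.NearCritical eta) (heta : 0 < eta) (hN : 0 < N)
    {Q : Finset (Fin n)} {c : Fin n} (hQ : H.IsFrontierStarAt θ Q c) (hc : c ∈ D)
    (hL : Disjoint (Q.erase c) D) (hbet : ∀ x ∈ D, ¬ BetweenSet θ (Q.erase c) x) :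
    ∃ f : Fin n → Fin N, (∀ v ∈ Q, f v ∈ V v) ∧
      ∀ u ∈ Q, ∀ v ∈ Q, H.adj u v → T.adj (f u) (f v) := by
  obtain ⟨hD, hnD, hdisj, hcomp⟩ := hV
  have hne : ∀ l ∈ Q.erase c, c ≠ l := fun l hl h => (mem_erase.1 hl).1 h.symm
  have hlD : ∀ l ∈ Q.erase c, l ∉ D := fun l hl => disjoint_left.1 hL hl
  have hpos : ∀ u ∈ Q.erase c, ∀ v ∈ Q.erase c, H.adj u v → pos θ u < pos θ v := by
    intro u hu v hv huv
    by_contra hnot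
    have hback : H.Backward θ u v :=
      ⟨huv, (pos_lt_or_gt θ (ne_of_adj huv)).resolve_left hnot⟩
    rcases hQ with hQ | hQ
    · exact hne v hv (hQ.2.2.2 u (mem_of_mem_erase hu) v (mem_of_mem_erase hv) hback).symm
    · exact hne u hu (hQ.2.2.2 u (mem_of_mem_erase hu) v (mem_of_mem_erase hv) hback).symm
  have hcard : ((#(Q.erase c) : ℝ) + 1) * (eta * N) ≤ #(V c) := by
    have : (#(Q.erase c) : ℝ) ≤ n := by
      exact_mod_cast (card_le_univ (Q.erase c)).trans_eq (Fintype.card_fin n)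
    exact le_trans (by gcongr) (hD c hc)
  have hr : ∃ a ∈ V c, ∀ l ∈ Q.erase c, ∃ s ∈ V l, (H.adj c l → T.adj a s) ∧
      (H.adj l c → T.adj s a) := by
    have key : ∀ r : Fin N → Fin N → Prop, (r = T.adj ∨ r = fun x y => T.adj y x) →
        ∃ a ∈ V c, ∀ l ∈ Q.erase c, ∃ s ∈ V l, r a s := by
      intro r hr
      have h := hT.le_card_filter (Q.erase c) V (V c) (fun l hl => hdisj c hc l (hne l hl))
        (fun l hl => (hnD l (hlD l hl)).1) (fun l hl => (hnD l (hlD l hl)).2) hcard r hr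
      have hN' : (0 : ℝ) < eta * N := by positivity
      obtain ⟨a, ha⟩ := card_pos.1 (Nat.cast_pos.1 (hN'.trans_le h))
      simp only [mem_filter] at ha
      exact ⟨a, ha⟩
    rcases hQ with hQ | hQ
    · obtain ⟨a, ha, h⟩ := key (fun x y => T.adj y x) (Or.inr rfl)
      refine ⟨a, ha, fun l hl => ?_⟩
      obtain ⟨s, hs, has⟩ := h l hl
      exact ⟨s, hs, fun h => absurd h (H.asymm _ _ (hQ.2.2.1 l hl).2), fun _ => has⟩
    · obtain ⟨a, ha, h⟩ := key T.adj (Or.inl rfl)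
      refine ⟨a, ha, fun l hl => ?_⟩
      obtain ⟨s, hs, has⟩ := h l hl
      exact ⟨s, hs, fun _ => has, fun h => absurd h (H.asymm _ _ (hQ.2.2.1 l hl).2)⟩
  obtain ⟨a, ha, hs⟩ := hr
  have hs' : ∀ l, ∃ s, l ∈ Q.erase c → s ∈ V l ∧ (H.adj c l → T.adj a s) ∧
      (H.adj l c → T.adj s a) := fun l => by
    by_cases hl : l ∈ Q.erase c
    · obtain ⟨s, h⟩ := hs l hl
      exact ⟨s, fun _ => h⟩
    · exact ⟨a, fun h => absurd h hl⟩
  choose s hs using hs'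
  refine ⟨Function.update s c a, fun v hv => ?_, fun u hu v hv huv => ?_⟩
  · by_cases hvc : v = c
    · rw [hvc, Function.update_self]; exact ha
    · rw [Function.update_of_ne hvc]
      exact (hs v (mem_erase.2 ⟨hvc, hv⟩)).1
  · by_cases huc : u = c <;> by_cases hvc : v = c
    · exact absurd huv (huc ▸ hvc ▸ H.irrefl _)
    · rw [Function.update_of_ne hvc, huc, Function.update_self]
      exact (hs v (mem_erase.2 ⟨hvc, hv⟩)).2.1 (huc ▸ huv)
    · rw [Function.update_of_ne huc, hvc, Function.update_self]
      exact (hs u (mem_erase.2 ⟨huc, hu⟩)).2.2 (hvc ▸ huv)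
    · rw [Function.update_of_ne huc, Function.update_of_ne hvc]
      have hu := mem_erase.2 ⟨huc, hu⟩
      have hv := mem_erase.2 ⟨hvc, hv⟩
      exact hcomp u v (hlD u hu) (hlD v hv) (rankIn_eq_of_not_between hL hbet hu hv)
        (hpos u hu v hv huv) _ (hs u hu).1 _ (hs v hv).1

/-- In a near critical tournament, a super right 2-nebula with centers in `D` can be found in a
placement that has no transitive triple `z → y → x`, `z → x` with `x` and `y` in the sets of
the centers and `z` in the set of a leaf. -/
theorem IsPlacement.exists_super2Nebula {n : ℕ} {T : Tournament N} {H : Tournament n}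
    {eta : ℝ} {θ : Equiv.Perm (Fin n)} {D : Finset (Fin n)} {V : Fin n → Finset (Fin N)}
    (hV : T.IsPlacement eta θ D V) (hT : T.NearCritical eta) (heta : 0 < eta)
    (heta' : eta ≤ 1 / 2) {S L₁ L₂ : Finset (Fin n)} {c₁ c₂ : Fin n}
    (hS : H.IsSuper2NebulaAt θ S c₁ c₂ L₁ L₂ NebKind.right) (hc₁ : c₁ ∈ D) (hc₂ : c₂ ∈ D)
    (hL : Disjoint (L₁ ∪ L₂) D) (hbet : ∀ x ∈ D, ¬ BetweenSet θ (L₁ ∪ L₂) x)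
    (hfree : ∀ l ∈ L₁ ∪ L₂, ∀ x ∈ V c₁, ∀ y ∈ V c₂, ∀ z ∈ V l, T.adj y x → T.adj z x →
      ¬ T.adj z y) :
    ∃ f : Fin n → Fin N, (∀ v ∈ S, f v ∈ V v) ∧
      ∀ u ∈ S, ∀ v ∈ S, H.adj u v → T.adj (f u) (f v) := by
  obtain ⟨hD, hnD, hdisj, hcomp⟩ := hV
  obtain ⟨⟨-, -, hL₁₂, hc₁L, hc₂L, hcc, rfl, hcpos⟩, hLpos, hadj₁, hadj₂, hadj, hback⟩ := hS
  have hlD : ∀ l ∈ L₁ ∪ L₂, l ∉ D := fun l hl => disjoint_left.1 hL hl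
  have hfilter : ∀ c ∈ D, ∀ L ⊆ L₁ ∪ L₂,
      eta * N ≤ (#{a ∈ V c | ∀ l ∈ L, ∃ s ∈ V l, T.adj s a} : ℝ) := by
    intro c hc L hLs
    have hcard : ((#L : ℝ) + 1) * (eta * N) ≤ #(V c) := by
      have : (#L : ℝ) ≤ n := by
        exact_mod_cast (card_le_univ L).trans_eq (Fintype.card_fin n)
      exact le_trans (by gcongr) (hD c hc)
    convert hT.le_card_filter L V (V c)
      (fun l hl => hdisj c hc l fun h => hlD l (hLs hl) (h ▸ hc))
      (fun l hl => (hnD l (hlD l (hLs hl))).1) (fun l hl => (hnD l (hlD l (hLs hl))).2)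
      hcard (fun x y => T.adj y x) (Or.inr rfl)
  have hX := hT.2 _ (hfilter c₁ hc₁ L₁ subset_union_left)
  have hY := hT.2 _ (hfilter c₂ hc₂ L₂ subset_union_right)
  have htr : 0 ≤ (1 / 2 - eta) * T.trSize := mul_nonneg (by linarith) (Nat.cast_nonneg _)
  obtain ⟨x, hx, y, hy, hyx⟩ := exists_adj_of_trSize_lt
    (disjoint_of_subset_left (filter_subset _ _)
      (disjoint_of_subset_right (filter_subset _ _) (hdisj c₁ hc₁ c₂ hcc)))
    (show (T.trSize : ℝ) < _ by linarith)
  obtain ⟨hx, hxs⟩ := mem_filter.1 hx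
  obtain ⟨hy, hys⟩ := mem_filter.1 hy
  have hs : ∀ l, ∃ s, l ∈ L₁ ∪ L₂ → s ∈ V l ∧ (l ∈ L₁ → T.adj s x ∧ T.adj y s) ∧
      (l ∈ L₂ → T.adj s y ∧ T.adj x s) := fun l => by
    by_cases hl : l ∈ L₁ ∪ L₂
    · rcases mem_union.1 hl with hl' | hl'
      · obtain ⟨s, hs, hsx⟩ := hxs l hl'
        have hne : s ≠ y := by
          rintro rfl
          exact disjoint_left.1 (hdisj c₂ hc₂ l fun h => hlD l hl (h ▸ hc₂)) hy hs
        exact ⟨s, fun _ => ⟨hs, fun _ => ⟨hsx, (T.total s y hne).resolve_left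
          (hfree l hl x hx y hy s hs hyx hsx)⟩,
          fun h => absurd h (disjoint_left.1 hL₁₂ hl')⟩⟩
      · obtain ⟨s, hs, hsy⟩ := hys l hl'
        have hne : s ≠ x := by
          rintro rfl
          exact disjoint_left.1 (hdisj c₁ hc₁ l fun h => hlD l hl (h ▸ hc₁)) hx hs
        exact ⟨s, fun _ => ⟨hs, fun h => absurd hl' (disjoint_left.1 hL₁₂ h),
          fun _ => ⟨hsy, (T.total s x hne).resolve_left
            fun h => hfree l hl x hx y hy s hs hyx h hsy⟩⟩⟩
    · exact ⟨x, fun h => absurd h hl⟩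
  choose s hs using hs
  have hf₁ : Function.update (Function.update s c₁ x) c₂ y c₁ = x := by
    rw [Function.update_of_ne hcc, Function.update_self]
  have hf₂ : Function.update (Function.update s c₁ x) c₂ y c₂ = y := Function.update_self ..
  have hfl : ∀ l ∈ L₁ ∪ L₂, Function.update (Function.update s c₁ x) c₂ y l = s l :=
    fun l hl => by
      rw [Function.update_of_ne (ne_of_mem_of_not_mem hl hc₂L),
        Function.update_of_ne (ne_of_mem_of_not_mem hl hc₁L)]
  refine ⟨Function.update (Function.update s c₁ x) c₂ y, fun v hv => ?_,
    fun u hu v hv huv => ?_⟩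
  · rcases mem_insert.1 hv with rfl | hv
    · rwa [hf₁]
    rcases mem_insert.1 hv with rfl | hv
    · rwa [hf₂]
    · rw [hfl v hv]; exact (hs v hv).1
  · have hpos : u ∈ L₁ ∪ L₂ → v ∈ L₁ ∪ L₂ → pos θ u < pos θ v := by
      intro hul hvl
      by_contra hnot
      rcases hback u hu v hv ⟨huv, (pos_lt_or_gt θ (ne_of_adj huv)).resolve_left
          hnot⟩ with ⟨-, h⟩ | ⟨-, h⟩ | ⟨-, h⟩
      exacts [hc₁L (h ▸ hvl), hc₂L (h ▸ hvl), hc₁L (h ▸ hvl)]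
    rcases mem_insert.1 hu with rfl | hul
    · rcases mem_insert.1 hv with rfl | hv
      · exact absurd huv (H.irrefl _)
      rcases mem_insert.1 hv with rfl | hv
      · exact absurd huv (H.asymm _ _ hadj)
      rw [hf₁, hfl v hv]
      rcases mem_union.1 hv with hv' | hv'
      exacts [absurd huv (H.asymm _ _ (hadj₁ v hv')), ((hs v hv).2.2 hv').2]
    rcases mem_insert.1 hul with rfl | hul'
    · rcases mem_insert.1 hv with rfl | hv
      · rwa [hf₁, hf₂]
      rcases mem_insert.1 hv with rfl | hv
      · exact absurd huv (H.irrefl _)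
      rw [hf₂, hfl v hv]
      rcases mem_union.1 hv with hv' | hv'
      exacts [((hs v hv).2.1 hv').2, absurd huv (H.asymm _ _ (hadj₂ v hv'))]
    rw [hfl u hul']
    rcases mem_insert.1 hv with rfl | hv
    · rw [hf₁]
      rcases mem_union.1 hul' with hu' | hu'
      · exact ((hs u hul').2.1 hu').1
      · rcases hback u hu v (by simp) ⟨huv, hcpos.trans (hLpos u hul')⟩ with
          ⟨h, -⟩ | ⟨-, h⟩ | ⟨h, -⟩
        exacts [absurd hu' (disjoint_left.1 hL₁₂ h), absurd h hcc, absurd (h ▸ hul') hc₂L]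
    rcases mem_insert.1 hv with rfl | hv
    · rw [hf₂]
      rcases mem_union.1 hul' with hu' | hu'
      · rcases hback u hu v (by simp) ⟨huv, hLpos u hul'⟩ with
          ⟨-, h⟩ | ⟨h, -⟩ | ⟨h, -⟩
        exacts [absurd h.symm hcc, absurd h (disjoint_left.1 hL₁₂ hu'), absurd (h ▸ hul') hc₂L]
      · exact ((hs u hul').2.2 hu').1
    rw [hfl v hv]
    exact hcomp u v (hlD u hul') (hlD v hv) (rankIn_eq_of_not_between hL hbet hul' hv)
      (hpos hul' hv) _ (hs u hul').1 _ (hs v hv).1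

theorem IsFrontierStarAt.center_mem {n : ℕ} {H : Tournament n} {θ : Equiv.Perm (Fin n)}
    {Q : Finset (Fin n)} {c : Fin n} (hQ : H.IsFrontierStarAt θ Q c) : c ∈ Q :=
  hQ.elim (fun h => h.1) fun h => h.1

theorem IsFrontierStarAt.not_betweenSet {n : ℕ} {H : Tournament n} {θ : Equiv.Perm (Fin n)}
    {Q : Finset (Fin n)} {c : Fin n} (hQ : H.IsFrontierStarAt θ Q c) :
    ¬ BetweenSet θ (Q.erase c) c := by
  rintro ⟨u, hu, w, hw, huc, hcw⟩
  rcases hQ with hQ | hQ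
  · exact lt_asymm huc (hQ.2.2.1 u hu).1
  · exact lt_asymm hcw (hQ.2.2.1 w hw).1

theorem SigmaGalaxyDecomp.leaves_centers {n k : ℕ} {H : Tournament n}
    {θ : Equiv.Perm (Fin n)} {S L₁ L₂ : Finset (Fin n)} {c₁ c₂ : Fin n}
    {Q : Fin k → Finset (Fin n)} {ctr : Fin k → Fin n}
    (hH : H.SigmaGalaxyDecomp θ S c₁ c₂ L₁ L₂ NebKind.right Q ctr) {D : Finset (Fin n)}
    (hD : D = insert c₁ (insert c₂ (univ.image ctr))) :
    Disjoint (L₁ ∪ L₂) D ∧ ∀ x ∈ D, ¬ BetweenSet θ (L₁ ∪ L₂) x := by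
  obtain ⟨hS, hQ, -, hSQ, -, -, hLctr, -⟩ := hH
  have hSeq : S = insert c₁ (insert c₂ (L₁ ∪ L₂)) := hS.1.2.2.2.2.2.2.1
  have hmemD : ∀ x, x ∈ D ↔ x = c₁ ∨ x = c₂ ∨ ∃ j, ctr j = x := by simp [hD]
  constructor
  · refine disjoint_left.2 fun x hx hxD => ?_
    rcases (hmemD x).1 hxD with rfl | rfl | ⟨j, rfl⟩
    · exact hS.1.2.2.2.1 hx
    · exact hS.1.2.2.2.2.1 hx
    · exact disjoint_left.1 (hSQ j) (hSeq ▸ mem_insert_of_mem (mem_insert_of_mem hx))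
        (hQ j).center_mem
  · intro x hx
    rcases (hmemD x).1 hx with rfl | rfl | ⟨j, rfl⟩
    · rintro ⟨u, hu, -, -, hux, -⟩
      exact lt_asymm hux (hS.1.2.2.2.2.2.2.2.trans (hS.2.1 u hu))
    · rintro ⟨u, hu, -, -, hux, -⟩
      exact lt_asymm hux (hS.2.1 u hu)
    · exact hLctr j

/-- A right Σ-galaxy is contained in a chain with no transitive triple `z → y → x`, `z → x` in
the sets of the centers and leaves of its super 2-nebula. -/
theorem IsChain.contains_of_sigmaGalaxyDecomp {n k : ℕ} {H : Tournament n}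
    {θ : Equiv.Perm (Fin n)} {S L₁ L₂ : Finset (Fin n)} {c₁ c₂ : Fin n}
    {Q : Fin k → Finset (Fin n)} {ctr : Fin k → Fin n}
    (hH : H.SigmaGalaxyDecomp θ S c₁ c₂ L₁ L₂ NebKind.right Q ctr)
    {T : Tournament N} {lam c eta : ℝ} {m h : ℕ} {W : ℕ → Finset (Fin N)}
    (hW : T.IsChain lam c m Even W) (hlam : 0 ≤ lam) (hnh : n ≤ h)
    (hlamh : lam * (2 * h) ≤ 1 / (2 * h)) (hc : h ≤ c * T.trSize)
    (hT : T.NearCritical eta) (heta : 0 < eta) (heta' : eta ≤ 1 / 2) (hN : 0 < N)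
    (hceta : 4 * h * ((n + 1) * eta) ≤ c) {g : ℕ → ℕ} (hg : StrictMono g)
    (hm : 2 * g n + 1 < m) {D : Finset (Fin n)}
    (hD : D = insert c₁ (insert c₂ (univ.image ctr)))
    (hfree : ∀ l ∈ L₁ ∪ L₂, ∀ x ∈ W (slot θ D g c₁), ∀ y ∈ W (slot θ D g c₂),
      ∀ z ∈ W (slot θ D g l), T.adj y x → T.adj z x → ¬ T.adj z y) : T.Contains H := by
  obtain ⟨hLD, hLbet⟩ := hH.leaves_centers hD
  obtain ⟨hS, hQ, hQQ, hSQ, hcov, hback, -, hQc, hQctr⟩ := hH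
  have hh : 0 < h := c₁.pos.trans_le hnh
  have hSeq : S = insert c₁ (insert c₂ (L₁ ∪ L₂)) := hS.1.2.2.2.2.2.2.1
  have hcS : c₁ ∈ S ∧ c₂ ∈ S := by simp [hSeq]
  have hmemD : ∀ x, x ∈ D ↔ x = c₁ ∨ x = c₂ ∨ ∃ j, ctr j = x := by simp [hD]
  have hQD : ∀ j, Disjoint ((Q j).erase (ctr j)) D := by
    refine fun j => disjoint_left.2 fun x hx hxD => ?_
    rcases (hmemD x).1 hxD with rfl | rfl | ⟨i, rfl⟩
    · exact disjoint_left.1 (hSQ j) hcS.1 (mem_of_mem_erase hx)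
    · exact disjoint_left.1 (hSQ j) hcS.2 (mem_of_mem_erase hx)
    · have hij : i ≠ j := by rintro rfl; exact notMem_erase _ _ hx
      exact disjoint_left.1 (hQQ i j hij) (hQ i).center_mem (mem_of_mem_erase hx)
  have hQbet : ∀ j, ∀ x ∈ D, ¬ BetweenSet θ ((Q j).erase (ctr j)) x := by
    intro j x hx
    rcases (hmemD x).1 hx with rfl | rfl | ⟨i, rfl⟩
    · exact (hQc j).1
    · exact (hQc j).2
    · by_cases hij : i = j
      · exact hij ▸ (hQ i).not_betweenSet
      · exact hQctr i j hij
  refine hW.contains (θ := θ) (D := D) hlam hh hnh hlamh hc hg hm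
    (fun o : Option (Fin k) => o.elim S Q) (fun v => ?_) (fun i j hij => ?_)
    (fun u v huv => ?_) (fun o V hVW hVc hVcomp => ?_)
  · rcases hcov v with hv | ⟨j, hv⟩
    exacts [⟨none, hv⟩, ⟨some j, hv⟩]
  · match i, j with
    | none, none => exact absurd rfl hij
    | none, some j => exact hSQ j
    | some i, none => exact (hSQ i).symm
    | some i, some j => exact hQQ i j fun h => hij (h ▸ rfl)
  · rcases hback u v huv with h | ⟨j, h⟩
    exacts [⟨none, h⟩, ⟨some j, h⟩]
  · have hV := hW.isPlacement hh heta.le hceta hg hm hVW hVc hVcomp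
    match o with
    | none =>
      exact hV.exists_super2Nebula hT heta heta' hS ((hmemD _).2 (by simp))
        ((hmemD _).2 (by simp)) hLD hLbet fun l hl x hx y hy z hz =>
          hfree l hl x (hVW _ hx) y (hVW _ hy) z (hVW _ hz)
    | some j =>
      exact hV.exists_star hT heta hN (hQ j) ((hmemD _).2 (by simp)) (hQD j) (hQbet j)

theorem exists_strictMono_through {n h α β γ p q r : ℕ} (hαβ : α < β) (hβγ : β < γ)
    (hγ : γ ≤ n) (hn : n < h) (hp : h ≤ p) (hq : p + h ≤ q) (hr : q + h ≤ r) :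
    ∃ g : ℕ → ℕ, StrictMono g ∧ g α = p ∧ g β = q ∧ g γ = r ∧ g n ≤ r + n := by
  refine ⟨fun k => if k < β then p - α + k else if k < γ then q - β + k else r - γ + k,
    strictMono_nat_of_lt_succ fun k => ?_, ?_, ?_, ?_, ?_⟩
  all_goals
    beta_reduce
    split_ifs <;> omega

/-- If a chain contains no copy of some right Σ-galaxy, then any three large subsets of suitable
sets of the chain contain a transitive triple with all its arcs going backward. -/
theorem IsChain.exists_triangle {n k : ℕ} {H : Tournament n}
    {θ : Equiv.Perm (Fin n)} {S L₁ L₂ : Finset (Fin n)} {c₁ c₂ : Fin n}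
    {Q : Fin k → Finset (Fin n)} {ctr : Fin k → Fin n}
    (hH : H.SigmaGalaxyDecomp θ S c₁ c₂ L₁ L₂ NebKind.right Q ctr)
    {T : Tournament N} (hTH : ¬ T.Contains H) {lam lam' c c' eta : ℝ} {m h : ℕ}
    {U : ℕ → Finset (Fin N)}
    (hU : T.IsChain lam c m Even U) (hlam : 0 ≤ lam) (hnh : n < h)
    (hlam' : lam * (4 * h) ≤ lam') (hc' : c' * (4 * h) ≤ c)
    (hlamh : lam' * (2 * h) ≤ 1 / (2 * h)) (hc : h ≤ c' * T.trSize)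
    (hT : T.NearCritical eta) (heta : 0 < eta) (heta' : eta ≤ 1 / 2) (hN : 0 < N)
    (hceta : 4 * h * ((n + 1) * eta) ≤ c') {p q r : ℕ} (hp : h ≤ p) (hq : p + h ≤ q)
    (hr : q + h ≤ r) (hm : 2 * (r + n) + 1 < m) {X Y Z : Finset (Fin N)}
    (hX : X ⊆ U (2 * p + 1)) (hY : Y ⊆ U (2 * q + 1)) (hZ : Z ⊆ U (2 * r))
    (hXc : (#(U (2 * p + 1)) : ℝ) ≤ 4 * h * #X) (hYc : (#(U (2 * q + 1)) : ℝ) ≤ 4 * h * #Y)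
    (hZc : (#(U (2 * r)) : ℝ) ≤ 4 * h * #Z) :
    ∃ x ∈ X, ∃ y ∈ Y, ∃ z ∈ Z, T.adj y x ∧ T.adj z x ∧ T.adj z y := by
  by_contra! hno
  have hh0 : (0 : ℝ) < h := Nat.cast_pos.2 (Nat.zero_lt_of_lt hnh)
  have hh1 : (1 : ℝ) ≤ 4 * h := by
    have : (1 : ℝ) ≤ h := by exact_mod_cast Nat.zero_lt_of_lt hnh
    linarith
  set W : ℕ → Finset (Fin N) := fun i =>
    if i = 2 * p + 1 then X else if i = 2 * q + 1 then Y else if i = 2 * r then Z else U i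
    with hWdef
  have hWX : W (2 * p + 1) = X := by simp [hWdef]
  have hWY : W (2 * q + 1) = Y := by
    simp only [hWdef]
    rw [if_neg (by omega), if_pos trivial]
  have hWZ : W (2 * r) = Z := by
    simp only [hWdef]
    rw [if_neg (by omega), if_neg (by omega), if_pos trivial]
  have hW : T.IsChain lam' c' m Even W := by
    refine hU.shrink hlam (by positivity : (0 : ℝ) < 4 * h) (fun _ _ => Iff.rfl)
      (fun i _ => ?_) (fun i _ => ?_) hlam' hc'
    · simp only [hWdef]
      split_ifs with h1 h2 h3
      exacts [h1 ▸ hX, h2 ▸ hY, h3 ▸ hZ, Subset.refl _]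
    · simp only [hWdef]
      split_ifs with h1 h2 h3
      exacts [h1 ▸ hXc, h2 ▸ hYc, h3 ▸ hZc, le_mul_of_one_le_left (Nat.cast_nonneg _) hh1]
  obtain ⟨D, hD⟩ : ∃ D, D = insert c₁ (insert c₂ (univ.image ctr)) := ⟨_, rfl⟩
  obtain ⟨hLD, hLbet⟩ := hH.leaves_centers hD
  obtain ⟨⟨⟨l₀, hl₀⟩, -, -, -, -, -, -, hcpos⟩, hLpos, -⟩ := hH.1
  have hl₀' : l₀ ∈ L₁ ∪ L₂ := mem_union_left _ hl₀
  have hc₁D : c₁ ∈ D := by simp [hD]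
  have hc₂D : c₂ ∈ D := by simp [hD]
  obtain ⟨g, hg, hg₁, hg₂, hg₃, hgn⟩ := exists_strictMono_through (rankIn_lt hc₁D hcpos)
    (rankIn_lt hc₂D (hLpos l₀ hl₀')) (rankIn_le θ D l₀) hnh hp hq hr
  have hs₁ : slot θ D g c₁ = 2 * p + 1 := by simp [slot, hc₁D, hg₁]
  have hs₂ : slot θ D g c₂ = 2 * q + 1 := by simp [slot, hc₂D, hg₂]
  have hs₃ : ∀ l ∈ L₁ ∪ L₂, slot θ D g l = 2 * r := fun l hl => by
    rw [slot_eq_of_not_between hLD hLbet hl hl₀']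
    simp [slot, disjoint_left.1 hLD hl₀', hg₃]
  refine hTH (hW.contains_of_sigmaGalaxyDecomp hH (le_trans (by positivity) hlam') hnh.le hlamh hc hT
    heta heta' hN hceta hg (by omega) hD fun l hl => ?_)
  rw [hs₁, hs₂, hs₃ l hl, hWX, hWY, hWZ]
  exact hno

theorem IsChain.contains_of_triGalaxyDecomp {n k l : ℕ} {H : Tournament n}
    {θ : Equiv.Perm (Fin n)} {A B C : Fin l → Fin n} {Q : Fin k → Finset (Fin n)}
    {ctr : Fin k → Fin n}
    (hH : H.TriGalaxyDecomp θ A B C Q ctr fun i => ({A i, B i} : Finset (Fin n)))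
    {T : Tournament N} {lam c eta : ℝ} {m h : ℕ} {W : ℕ → Finset (Fin N)}
    (hW : T.IsChain lam c m Even W) (hlam : 0 ≤ lam) (hh : 0 < h) (hnh : n ≤ h)
    (hlamh : lam * (2 * h) ≤ 1 / (2 * h)) (hc : h ≤ c * T.trSize)
    (hT : T.NearCritical eta) (heta : 0 < eta) (hN : 0 < N)
    (hceta : 4 * h * ((n + 1) * eta) ≤ c) {g : ℕ → ℕ} (hg : StrictMono g)
    (hm : 2 * g n + 1 < m)
    (htri : ∀ α β γ, α < β → β < γ → γ ≤ n → ∀ X Y Z : Finset (Fin N),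
      X ⊆ W (2 * g α + 1) → Y ⊆ W (2 * g β + 1) → Z ⊆ W (2 * g γ) →
      (#(W (2 * g α + 1)) : ℝ) ≤ 4 * h * #X → (#(W (2 * g β + 1)) : ℝ) ≤ 4 * h * #Y →
      (#(W (2 * g γ)) : ℝ) ≤ 4 * h * #Z →
      ∃ x ∈ X, ∃ y ∈ Y, ∃ z ∈ Z, T.adj y x ∧ T.adj z x ∧ T.adj z y) : T.Contains H := by
  obtain ⟨htr, hQ, htt, htQ, hQQ, hback, hQctr, hforb⟩ := hH
  obtain ⟨D, hmemD⟩ : ∃ D : Finset (Fin n), ∀ x, x ∈ D ↔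
      (∃ i, x = A i ∨ x = B i) ∨ ∃ j, ctr j = x :=
    ⟨univ.biUnion (fun i => {A i, B i}) ∪ univ.image ctr, by simp⟩
  have hA : ∀ i, A i ∈ D := fun i => (hmemD _).2 (Or.inl ⟨i, Or.inl rfl⟩)
  have hB : ∀ i, B i ∈ D := fun i => (hmemD _).2 (Or.inl ⟨i, Or.inr rfl⟩)
  have hC : ∀ i, C i ∉ D := by
    intro i hCi
    have hCmem : C i ∈ ({A i, B i, C i} : Finset (Fin n)) := by simp
    rcases (hmemD _).1 hCi with ⟨j, hj⟩ | ⟨j, hj⟩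
    · by_cases hij : i = j
      · subst hij
        rcases hj with hj | hj
        · exact ((htr i).1.trans (htr i).2.1).ne' (congrArg (pos θ) hj)
        · exact (htr i).2.1.ne' (congrArg (pos θ) hj)
      · refine disjoint_left.1 (htt i j hij) hCmem ?_
        rcases hj with hj | hj <;> simp [hj]
    · exact disjoint_left.1 (htQ i j) hCmem (hj ▸ (hQ j).center_mem)
  have hQD : ∀ j, Disjoint ((Q j).erase (ctr j)) D := by
    refine fun j => disjoint_left.2 fun x hx hxD => ?_
    rcases (hmemD x).1 hxD with ⟨i, hi⟩ | ⟨i, rfl⟩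
    · refine disjoint_left.1 (htQ i j) ?_ (mem_of_mem_erase hx)
      rcases hi with hi | hi <;> simp [hi]
    · have hij : i ≠ j := by rintro rfl; exact notMem_erase _ _ hx
      exact disjoint_left.1 (hQQ i j hij) (hQ i).center_mem (mem_of_mem_erase hx)
  have hQbet : ∀ j, ∀ x ∈ D, ¬ BetweenSet θ ((Q j).erase (ctr j)) x := by
    intro j x hx
    rcases (hmemD x).1 hx with ⟨i, hi⟩ | ⟨i, rfl⟩
    · exact hforb i j x (by simpa using hi)
    · by_cases hij : i = j
      · exact hij ▸ (hQ i).not_betweenSet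
      · exact hQctr i j hij
  set F : Finset (Fin n) := {x | (∀ i, x ∉ ({A i, B i, C i} : Finset (Fin n))) ∧ ∀ j, x ∉ Q j}
    with hF
  have hmemF : ∀ x ∈ F, (∀ i, x ∉ ({A i, B i, C i} : Finset (Fin n))) ∧ ∀ j, x ∉ Q j :=
    fun x hx => (mem_filter.1 hx).2
  refine hW.contains (θ := θ) (D := D) hlam hh hnh hlamh hc hg hm
    (Sum.elim (fun i => {A i, B i, C i}) (Sum.elim Q fun x : F => {x.1}))
    (fun v => ?_) (fun i j hij => ?_) (fun u v huv => ?_) (fun o V hVW hVc hVcomp => ?_)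
  · by_cases hv : v ∈ F
    · exact ⟨Sum.inr (Sum.inr ⟨v, hv⟩), mem_singleton_self v⟩
    · simp only [hF, mem_filter, mem_univ, true_and, not_and_or, not_forall, not_not] at hv
      rcases hv with ⟨i, hi⟩ | ⟨j, hj⟩
      exacts [⟨Sum.inl i, hi⟩, ⟨Sum.inr (Sum.inl j), hj⟩]
  · match i, j with
    | Sum.inl i, Sum.inl j => exact htt i j fun h => hij (h ▸ rfl)
    | Sum.inl i, Sum.inr (Sum.inl j) => exact htQ i j
    | Sum.inl i, Sum.inr (Sum.inr x) => exact disjoint_singleton_right.2 ((hmemF x x.2).1 i)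
    | Sum.inr (Sum.inl i), Sum.inl j => exact (htQ j i).symm
    | Sum.inr (Sum.inl i), Sum.inr (Sum.inl j) => exact hQQ i j fun h => hij (h ▸ rfl)
    | Sum.inr (Sum.inl i), Sum.inr (Sum.inr x) =>
      exact disjoint_singleton_right.2 ((hmemF x x.2).2 i)
    | Sum.inr (Sum.inr x), Sum.inl j => exact disjoint_singleton_left.2 ((hmemF x x.2).1 j)
    | Sum.inr (Sum.inr x), Sum.inr (Sum.inl j) =>
      exact disjoint_singleton_left.2 ((hmemF x x.2).2 j)
    | Sum.inr (Sum.inr x), Sum.inr (Sum.inr y) =>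
      exact disjoint_singleton.2 fun h => hij (by rw [Subtype.ext h])
  · rcases hback u v huv with ⟨i, h⟩ | ⟨j, h⟩
    exacts [⟨Sum.inl i, h⟩, ⟨Sum.inr (Sum.inl j), h⟩]
  · have hV := hW.isPlacement hh heta.le hceta hg hm hVW hVc hVcomp
    match o with
    | Sum.inl i =>
      have hsA : slot θ D g (A i) = 2 * g (rankIn θ D (A i)) + 1 := by simp [slot, hA]
      have hsB : slot θ D g (B i) = 2 * g (rankIn θ D (B i)) + 1 := by simp [slot, hB]
      have hsC : slot θ D g (C i) = 2 * g (rankIn θ D (C i)) := by simp [slot, hC]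
      obtain ⟨h1, h2, h3, h4, h5⟩ := htr i
      obtain ⟨x, hx, y, hy, z, hz, hyx, hzx, hzy⟩ := htri _ _ _ (rankIn_lt (hA i) h1)
        (rankIn_lt (hB i) h2) (rankIn_le θ D (C i)) (V (A i)) (V (B i)) (V (C i))
        (hsA ▸ hVW _) (hsB ▸ hVW _) (hsC ▸ hVW _) (hsA ▸ hVc _) (hsB ▸ hVc _) (hsC ▸ hVc _)
      have hAB : B i ≠ A i := fun h => h1.ne' (congrArg (pos θ) h)
      have hBC : C i ≠ B i := fun h => h2.ne' (congrArg (pos θ) h)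
      have hAC : C i ≠ A i := fun h => (h1.trans h2).ne' (congrArg (pos θ) h)
      have h3' := H.asymm _ _ h3
      have h4' := H.asymm _ _ h4
      have h5' := H.asymm _ _ h5
      refine ⟨fun v => if v = A i then x else if v = B i then y else z, ?_, ?_⟩
      · simp [hAB, hBC, hAC, hx, hy, hz]
      · simp [hAB, hBC, hAC, hyx, hzx, hzy, h3', h4', h5', H.irrefl]
    | Sum.inr (Sum.inl j) =>
      exact hV.exists_star hT heta hN (hQ j) ((hmemD _).2 (by simp)) (hQD j) (hQbet j)
    | Sum.inr (Sum.inr x) =>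
      have hne : (V x).Nonempty := by
        rw [← card_pos, ← Nat.cast_pos (α := ℝ)]
        have hN' : (0 : ℝ) < N := Nat.cast_pos.2 hN
        by_cases hx : x.1 ∈ D
        · exact lt_of_lt_of_le (by positivity) (hV.1 x hx)
        · exact zero_lt_one.trans_le (hT.1.trans (hV.2.1 x hx).2)
      obtain ⟨y, hy⟩ := hne
      refine ⟨fun _ => y, fun v hv => ?_, fun u hu v hv huv => ?_⟩
      · exact (mem_singleton.1 hv).symm ▸ hy
      · exact absurd ((mem_singleton.1 hu).trans (mem_singleton.1 hv).symm) (ne_of_adj huv)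
end ErdosHajnal
end Tournament

open Tournament

theorem stmt10 {n₁ n₂ : ℕ} (H₁ : Tournament n₁) (H₂ : Tournament n₂)
    (h₁ : H₁.IsRightSigmaGalaxy) (h₂ : H₂.IsRightTriangularGalaxy) : EHPair H₁ H₂ := by
  obtain ⟨θ₁, S, c₁, c₂, L₁, L₂, k₁, Q₁, ctr₁, hH₁⟩ := h₁
  obtain ⟨θ₂, l, k₂, A, B, C, Q₂, ctr₂, hH₂⟩ := h₂
  obtain ⟨h, hh⟩ : ∃ h, h = n₁ + n₂ + 1 := ⟨_, rfl⟩
  have hh0 : 0 < h := by omega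
  have hhR : (1 : ℝ) ≤ h := by exact_mod_cast hh0
  have hn₁ : (n₁ : ℝ) + 1 ≤ h := by rw [hh]; push_cast; linarith [Nat.cast_nonneg (α := ℝ) n₂]
  have hn₂ : (n₂ : ℝ) + 1 ≤ h := by rw [hh]; push_cast; linarith [Nat.cast_nonneg (α := ℝ) n₁]
  obtain ⟨m, hm⟩ : ∃ m, m = 2 * (h * (n₂ + 1) + h) + 2 := ⟨_, rfl⟩
  obtain ⟨c, hc, hc2, hchain⟩ := exists_isChain H₁ m
    (show (0 : ℝ) < 1 / (16 * h ^ 3) by positivity)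
  obtain ⟨eta, heta⟩ : ∃ eta : ℝ, eta = c / (32 * h ^ 3) := ⟨_, rfl⟩
  have hceta : c = 32 * h ^ 3 * eta := by rw [heta]; field_simp
  have heta0 : 0 < eta := by rw [heta]; positivity
  have heta_c : eta ≤ c := by
    rw [heta]
    refine div_le_self hc.le ?_
    nlinarith [one_le_pow₀ (n := 3) hhR]
  obtain ⟨ε, hε, hcrit⟩ := exists_forall_nearCritical heta0
  refine ehPair_of_forall_not_epsCritical hε fun N T hT₁ hT₂ hTε => hT₂ ?_
  have hT := hcrit N T hTε
  obtain ⟨U, hU⟩ := hchain N T hT₁ (hT.mono heta_c)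
  have hN : 0 < N := by
    refine lt_of_lt_of_le (Nat.pos_of_ne_zero fun h0 => ?_) T.trSize_le
    have := hT.1
    rw [h0, Nat.cast_zero, mul_zero] at this
    exact absurd this (by norm_num)
  have hscale : ∀ t : ℝ, h ≤ t → h ≤ t * eta * T.trSize := fun t ht => by
    have := mul_le_mul ht hT.1 zero_le_one (by linarith)
    linarith
  have hg : StrictMono fun k => h * (k + 1) := fun a b hab =>
    Nat.mul_lt_mul_of_pos_left (Nat.succ_lt_succ hab) hh0
  refine hU.contains_of_triGalaxyDecomp hH₂ (by positivity) hh0 (by omega) ?_ ?_ hT heta0 hN ?_ hg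
    (by omega) fun α β γ hαβ hβγ hγ X Y Z hX hY hZ hXc hYc hZc =>
      hU.exists_triangle hH₁ hT₁ (lam' := 1 / (4 * h ^ 2)) (c' := 8 * h ^ 2 * eta)
        (by positivity) (by omega) ?_ ?_ ?_ (hscale _ ?_) hT heta0 (by linarith) hN ?_ ?_ ?_ ?_
        ?_ hX hY hZ hXc hYc hZc
  · rw [div_mul_eq_mul_div, div_le_div_iff₀ (by positivity) (by positivity)]
    nlinarith [one_le_pow₀ (n := 2) hhR, pow_le_pow_right₀ hhR (show 2 ≤ 3 by norm_num)]
  · rw [hceta]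
    exact hscale _ (by nlinarith [pow_le_pow_right₀ hhR (show 1 ≤ 3 by norm_num)])
  · rw [hceta, ← mul_assoc]
    refine mul_le_mul_of_nonneg_right ?_ heta0.le
    nlinarith [pow_le_pow_right₀ hhR (show 2 ≤ 3 by norm_num)]
  · exact le_of_eq (by field_simp; norm_num)
  · rw [hceta]
    exact le_of_eq (by ring)
  · exact le_of_eq (by field_simp; norm_num)
  · nlinarith
  · rw [← mul_assoc]
    refine mul_le_mul_of_nonneg_right ?_ heta0.le
    nlinarith
  · exact Nat.le_mul_of_pos_right h (Nat.succ_pos α)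
  · exact (Nat.mul_succ h (α + 1)).ge.trans (Nat.mul_le_mul_left h (by omega))
  · exact (Nat.mul_succ h (β + 1)).ge.trans (Nat.mul_le_mul_left h (by omega))
  · have := Nat.mul_le_mul_left h (Nat.succ_le_succ hγ)
    simp only [Nat.succ_eq_add_one] at this
    omega
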